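/- arXiv:1708.05381 — 2 statements merged into one kernel-verified Lean document; each statement's English description precedes it below -/
import Mathlib

section
/- Second-quadrant generating function: for all real z, w with z > 1 and 0 < w < 1, the (absolutely convergent) double series satisfies ∑_{x<0} ∑_{y≥0} g(x,y)·z^x·w^y = [ √2·(w/z − 1)/√(1−w²) + √(1 − 1/z²) ] / ( 4 − w/z − z/w − z·w − 1/(z·w) ). (The denominator equals 4 − (z+1/z)(w+1/w) and is nonzero for such z, w.) -/
/-- `g` is a slit-plane Green's function: the voltage `G_H` on the half-plane square
lattice `{(x,y) : y ≥ 0, x+y even}` with Dirichlet boundary on the negative `x`-axis,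
reflecting boundary on the positive `x`-axis, and one unit of current inserted at the
origin. -/
def IsSlitGreen (g : ℤ × ℤ → ℝ) : Prop :=
  -- g vanishes off the half-plane lattice
  (∀ x y : ℤ, (y < 0 ∨ Odd (x + y)) → g (x, y) = 0) ∧
  -- (i) Dirichlet boundary on the negative x-axis
  (∀ x : ℤ, x < 0 → g (x, 0) = 0) ∧
  -- (ii) harmonicity off the x-axis
  (∀ x y : ℤ, 1 ≤ y → Even (x + y) →
    4 * g (x, y) =
      g (x - 1, y - 1) + g (x + 1, y - 1) + g (x - 1, y + 1) + g (x + 1, y + 1)) ∧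
  -- (iii) reflecting boundary on the positive x-axis
  (∀ x : ℤ, 0 < x → Even x → 2 * g (x, 0) = g (x - 1, 1) + g (x + 1, 1)) ∧
  -- (iv) one unit of current inserted at the origin
  (2 * g (0, 0) - g (1, 1) - g (-1, 1) = 1) ∧
  -- (v) values between 0 and 1
  (∀ x y : ℤ, 0 ≤ g (x, y) ∧ g (x, y) ≤ 1) ∧
  -- (vi) decay at infinity
  (∀ ε : ℝ, 0 < ε → ∃ N : ℕ, ∀ x y : ℤ, (N : ℤ) ≤ |x| + |y| → |g (x, y)| < ε)

open Real Set MeasureTheory Filter Topology intervalIntegral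

theorem hasSum_of_binomial_recurrence {a t : ℝ} (ht : |t| < 1) {c : ℕ → ℝ}
    (hc : ∀ k : ℕ, ((k : ℝ) + 1) * c (k + 1) = (k - a) * c k) :
    HasSum (fun k => c k * t ^ k) (c 0 * (1 - t) ^ a) := by
  have hchoose : ∀ k : ℕ, ((k : ℝ) + 1) * Ring.choose a (k + 1) = (a - k) * Ring.choose a k := by
    intro k
    rw [Ring.choose_eq_smul, Ring.choose_eq_smul, descPochhammer_succ_right,
      Polynomial.smeval_mul, Nat.factorial_succ]
    have : ((k : ℝ) + 1) ≠ 0 := by positivity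
    have h2 : (k.factorial : ℝ) ≠ 0 := by positivity
    simp
    field_simp
    simp [Polynomial.smeval_natCast]
  have hcoef : ∀ k : ℕ, c k = c 0 * ((-1) ^ k * Ring.choose a k) := by
    intro k
    induction k with
    | zero => simp
    | succ k ih =>
      have : ((k : ℝ) + 1) ≠ 0 := by positivity
      apply mul_left_cancel₀ this
      rw [hc, ih, pow_succ]
      linear_combination (c 0 * (-1) ^ k) * hchoose k
  have h := (Real.one_add_rpow_hasFPowerSeriesOnBall_zero (a := a)).hasSum (y := -t)
    (by simpa [Metric.mem_eball, edist_dist] using ht)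
  simp only [zero_add, binomialSeries_apply, List.ofFn_const, List.prod_replicate, smul_eq_mul] at h
  have heq : (fun k => c k * t ^ k) = fun k => c 0 * (Ring.choose a k * (-t) ^ k) := by
    funext k
    rw [hcoef k, neg_pow t k]
    ring
  rw [heq, sub_eq_add_neg]
  exact h.mul_left (c 0)

/-- A maximum principle on the half-plane lattice, with decay expressed by finite superlevel sets. -/
theorem nonpos_of_subharmonic_of_finite {d : ℤ → ℕ → ℝ}
    (h_inner : ∀ (x : ℤ) (n : ℕ), Even (x + n + 1) →
      4 * d x (n + 1) ≤ d (x - 1) n + d (x + 1) n + d (x - 1) (n + 2) + d (x + 1) (n + 2))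
    (hpos : ∀ x : ℤ, 0 ≤ x → Even x → 2 * d x 0 ≤ d (x - 1) 1 + d (x + 1) 1)
    (hneg : ∀ x : ℤ, x < 0 → Even x → d x 0 ≤ 0)
    (hfin : ∀ ε : ℝ, 0 < ε → {p : ℤ × ℕ | ε ≤ d p.1 p.2}.Finite)
    {x : ℤ} {n : ℕ} (hxn : Even (x + n)) : d x n ≤ 0 := by
  by_contra! hlt
  have hsub : {p : ℤ × ℕ | Even (p.1 + p.2) ∧ d x n ≤ d p.1 p.2}.Finite :=
    (hfin _ hlt).subset fun p hp => hp.2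
  obtain ⟨q, ⟨hq, hxq⟩, hmax⟩ := Set.exists_max_image _ (fun p : ℤ × ℕ => d p.1 p.2) hsub
    ⟨(x, n), hxn, le_rfl⟩
  have hbd : ∀ (i : ℤ) (j : ℕ), Even (i + j) → d i j ≤ d q.1 q.2 := by
    intro i j hij
    by_cases h : d x n ≤ d i j
    · exact hmax (i, j) ⟨hij, h⟩
    · exact (not_le.1 h).le.trans hxq
  have hprop : ∀ k : ℕ, d (q.1 + k) (q.2 + k) = d q.1 q.2 := by
    intro k
    induction k with
    | zero => simp
    | succ k ih =>
      have hev : Even (q.1 + k + (q.2 + k : ℕ)) := by push_cast; grind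
      generalize hi : q.1 + (k : ℤ) = i at *
      generalize hj : q.2 + k = j at *
      have e1 : q.1 + ((k + 1 : ℕ) : ℤ) = i + 1 := by push_cast; omega
      have e2 : q.2 + (k + 1) = j + 1 := by omega
      rw [e1, e2]
      refine le_antisymm (hbd _ _ (by push_cast; grind)) ?_
      rcases j with _ | j
      · rcases lt_or_ge i 0 with h | h
        · linarith [hneg i h (by simpa using hev)]
        · have h1 := hpos i h (by simpa using hev)
          have h2 := hbd (i - 1) 1 (by push_cast; grind)
          simp only [zero_add]
          linarith
      · have h1 := h_inner i j (by push_cast at hev; grind)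
        have h2 := hbd (i - 1) j (by push_cast at hev; grind)
        have h3 := hbd (i + 1) j (by push_cast at hev; grind)
        have h4 := hbd (i - 1) (j + 2) (by push_cast at hev ⊢; grind)
        have h5 : d (i + 1) (j + 1 + 1) = d (i + 1) (j + 2) := rfl
        linarith
  refine Set.infinite_of_injective_forall_mem (f := fun k : ℕ => (q.1 + (k : ℤ), q.2 + k))
    (fun a b hab => ?_) (fun k => ?_) (hfin _ hlt)
  · simpa using hab
  · simpa [hprop k] using hxq

/-- The weight `1 / √(2 sin θ)`. -/
noncomputable def slitWeight (θ : ℝ) : ℝ := (√(2 * sin θ))⁻¹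

/-- The decay factor `cos θ / (1 + sin θ)`; it solves `cos θ * (1 + r ^ 2) = 2 * r`. -/
noncomputable def slitRate (θ : ℝ) : ℝ := cos θ / (1 + sin θ)

/-- The horizontal mode `cos ((x + 1/2) θ - π/4)`. -/
noncomputable def slitMode (x θ : ℝ) : ℝ := cos ((x + 1 / 2) * θ - π / 4)

/-- The normalized integral of `k` over `[0, π]` against `slitWeight`. -/
noncomputable def slitMean (k : ℝ → ℝ) : ℝ := π⁻¹ * ∫ θ in (0 : ℝ)..π, k θ * slitWeight θ

/-- The Fourier integral representing the slit-plane Green's function. -/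
noncomputable def slitIntegral (x : ℤ) (n : ℕ) : ℝ :=
  slitMean fun θ => slitMode x θ * slitRate θ ^ n

theorem one_add_sin_pos {θ : ℝ} (h : θ ∈ Icc 0 π) : 0 < 1 + sin θ := by
  linarith [sin_nonneg_of_mem_Icc h]

theorem sqrt_two_mul_sin_pos {θ : ℝ} (h : θ ∈ Ioo 0 π) : 0 < √(2 * sin θ) :=
  Real.sqrt_pos.2 (by linarith [sin_pos_of_mem_Ioo h])

theorem slitMode_zero_pos {θ : ℝ} (h : θ ∈ Icc 0 π) : 0 < slitMode 0 θ := by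
  unfold slitMode
  apply cos_pos_of_mem_Ioo
  constructor <;> linarith [h.1, h.2, pi_pos]

theorem continuous_slitMode (x : ℝ) : Continuous (slitMode x) := by
  unfold slitMode; fun_prop

theorem continuousOn_slitRate : ContinuousOn slitRate (Icc 0 π) := by
  unfold slitRate
  exact ContinuousOn.div (by fun_prop) (by fun_prop) fun θ h => (one_add_sin_pos h).ne'

theorem slitMode_add_one_add_slitMode_sub_one (x θ : ℝ) :
    slitMode (x - 1) θ + slitMode (x + 1) θ = 2 * cos θ * slitMode x θ := by
  unfold slitMode
  rw [show (x - 1 + 1 / 2) * θ - π / 4 = ((x + 1 / 2) * θ - π / 4) - θ by ring,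
    show (x + 1 + 1 / 2) * θ - π / 4 = ((x + 1 / 2) * θ - π / 4) + θ by ring, cos_sub, cos_add]
  ring

theorem slitMode_zero_sq (θ : ℝ) : slitMode 0 θ ^ 2 = (1 + sin θ) / 2 := by
  unfold slitMode
  rw [cos_sq, show 2 * ((0 + 1 / 2) * θ - π / 4) = θ - π / 2 by ring, cos_sub_pi_div_two]
  ring

theorem slitRate_mul {θ : ℝ} (h : θ ∈ Icc 0 π) : slitRate θ * (1 + sin θ) = cos θ := by
  have h1 := one_add_sin_pos h
  unfold slitRate
  field_simp

theorem sin_half_sub_pi_div_four {θ : ℝ} (h : θ ∈ Icc 0 π) :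
    sin ((0 + 1 / 2) * θ - π / 4) = -(slitRate θ * slitMode 0 θ) := by
  have h1 := slitRate_mul h
  have h2 := slitMode_zero_pos h
  have h3 : 2 * sin ((0 + 1 / 2) * θ - π / 4) * slitMode 0 θ = -cos θ := by
    unfold slitMode
    rw [← sin_two_mul, show 2 * ((0 + 1 / 2) * θ - π / 4) = θ - π / 2 by ring, sin_sub_pi_div_two]
  have h4 := slitMode_zero_sq θ
  apply mul_right_cancel₀ h2.ne'
  linear_combination h3 / 2 + slitRate θ * h4 + h1 / 2

theorem slitMode_neg_one {θ : ℝ} (h : θ ∈ Icc 0 π) :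
    slitMode (-1) θ = slitRate θ * slitMode 0 θ := by
  have := sin_half_sub_pi_div_four h
  have h2 : slitMode (-1) θ = -sin ((0 + 1 / 2) * θ - π / 4) := by
    unfold slitMode
    rw [← cos_add_pi_div_two, ← cos_neg]
    ring_nf
  rw [h2, this, neg_neg]

theorem slitRate_sq {θ : ℝ} (h : θ ∈ Icc 0 π) :
    slitRate θ ^ 2 * (1 + sin θ) = 1 - sin θ := by
  have h1 := one_add_sin_pos h
  unfold slitRate
  field_simp
  linear_combination sin_sq_add_cos_sq θ

theorem cos_mul_one_add_slitRate_sq {θ : ℝ} (h : θ ∈ Icc 0 π) :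
    cos θ * (1 + slitRate θ ^ 2) = 2 * slitRate θ := by
  have h1 := one_add_sin_pos h
  have h2 := slitRate_sq h
  have h3 := slitRate_mul h
  apply mul_right_cancel₀ h1.ne'
  linear_combination cos θ * h2 - 2 * h3

theorem abs_slitRate_lt_one {θ : ℝ} (h : θ ∈ Ioo 0 π) : |slitRate θ| < 1 := by
  have h1 := one_add_sin_pos (Ioo_subset_Icc_self h)
  have h2 := slitRate_sq (Ioo_subset_Icc_self h)
  have h3 := sin_pos_of_mem_Ioo h
  rw [← sq_lt_one_iff_abs_lt_one]
  nlinarith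

theorem hasDerivAt_slitRate {θ : ℝ} (h : θ ∈ Icc 0 π) :
    HasDerivAt slitRate (-(1 + sin θ)⁻¹) θ := by
  have h1 := one_add_sin_pos h
  have := (hasDerivAt_cos θ).div ((hasDerivAt_sin θ).const_add 1) h1.ne'
  refine this.congr_deriv ?_
  field_simp
  linear_combination -sin_sq_add_cos_sq θ

theorem hasDerivAt_sqrt_two_mul_sin {θ : ℝ} (h : θ ∈ Ioo 0 π) :
    HasDerivAt (fun θ => √(2 * sin θ)) (cos θ * slitWeight θ) θ := by
  have h1 := sin_pos_of_mem_Ioo h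
  have h2 := sqrt_two_mul_sin_pos h
  have := ((hasDerivAt_sin θ).const_mul 2).sqrt (by positivity)
  refine this.congr_deriv ?_
  unfold slitWeight
  field_simp

theorem sqrt_eq_mul_slitWeight {θ : ℝ} (h : θ ∈ Ioo 0 π) :
    √(2 * sin θ) = 2 * sin θ * slitWeight θ := by
  have h1 := sin_pos_of_mem_Ioo h
  have h2 := sqrt_two_mul_sin_pos h
  unfold slitWeight
  field_simp
  exact Real.sq_sqrt (by positivity)

theorem hasDerivAt_cos_linear (a b θ : ℝ) :
    HasDerivAt (fun θ => cos (a * θ - b)) (-(a * sin (a * θ - b))) θ := by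
  have := (((hasDerivAt_id θ).const_mul a).sub_const b).cos
  simpa [mul_comm] using this

theorem hasDerivAt_sin_linear (a b θ : ℝ) :
    HasDerivAt (fun θ => sin (a * θ - b)) (a * cos (a * θ - b)) θ := by
  have := (((hasDerivAt_id θ).const_mul a).sub_const b).sin
  simpa [mul_comm] using this

theorem continuous_sqrt_two_mul_sin : Continuous fun θ : ℝ => √(2 * sin θ) := by fun_prop

theorem hasDerivAt_arcsin_slit {θ : ℝ} (h : θ ∈ Ioo 0 π) :
    HasDerivAt (fun θ => arcsin (√2 * sin ((0 + 1 / 2) * θ - π / 4)))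
      (slitMode 0 θ * slitWeight θ) θ := by
  have h1 := sin_pos_of_mem_Ioo h
  have h2 := sqrt_two_mul_sin_pos h
  have h3 : 1 - (√2 * sin ((0 + 1 / 2) * θ - π / 4)) ^ 2 = sin θ := by
    have := slitMode_zero_sq θ
    unfold slitMode at this
    rw [mul_pow, Real.sq_sqrt (by norm_num), sin_sq, this]
    ring
  have h4 : |√2 * sin ((0 + 1 / 2) * θ - π / 4)| < 1 := by
    rw [← sq_lt_one_iff_abs_lt_one]; linarith
  have h5 := (hasDerivAt_arcsin (abs_lt.1 h4).1.ne' (abs_lt.1 h4).2.ne).comp θ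
    ((hasDerivAt_sin_linear (0 + 1 / 2) (π / 4) θ).const_mul √2)
  refine h5.congr_deriv ?_
  rw [h3]
  unfold slitMode slitWeight
  rw [Real.sqrt_mul (by norm_num)]
  have : √2 ≠ 0 := by positivity
  have : √(sin θ) ≠ 0 := by positivity
  have h6 : √2 ^ 2 = 2 := Real.sq_sqrt (by norm_num)
  field_simp
  rw [h6]; ring

theorem intervalIntegrable_slitWeight : IntervalIntegrable slitWeight volume 0 π := by
  have h1 : IntervalIntegrable (fun θ => slitMode 0 θ * slitWeight θ) volume 0 π := by
    apply intervalIntegrable_deriv_of_nonneg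
      (g := fun θ => arcsin (√2 * sin ((0 + 1 / 2) * θ - π / 4)))
    · fun_prop
    · intro θ h
      rw [min_eq_left pi_pos.le, max_eq_right pi_pos.le] at h
      exact hasDerivAt_arcsin_slit h
    · intro θ h
      rw [min_eq_left pi_pos.le, max_eq_right pi_pos.le] at h
      exact mul_nonneg (slitMode_zero_pos (Ioo_subset_Icc_self h)).le
        (inv_nonneg.2 (Real.sqrt_nonneg _))
  have h2 : ContinuousOn (fun θ => (slitMode 0 θ)⁻¹) (uIcc 0 π) := by
    rw [uIcc_of_le pi_pos.le]
    exact (continuous_slitMode 0).continuousOn.inv₀ fun θ h => (slitMode_zero_pos h).ne'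
  refine (h1.continuousOn_mul h2).congr fun θ h => ?_
  rw [uIoc_of_le pi_pos.le] at h
  have := (slitMode_zero_pos (Ioc_subset_Icc_self h)).ne'
  field_simp

theorem intervalIntegrable_mul_slitWeight {k : ℝ → ℝ} (hk : ContinuousOn k (Icc 0 π)) :
    IntervalIntegrable (fun θ => k θ * slitWeight θ) volume 0 π :=
  intervalIntegrable_slitWeight.continuousOn_mul (by rwa [uIcc_of_le pi_pos.le])

theorem slitMean_eq_sub {F k : ℝ → ℝ} (hF : ContinuousOn F (Icc 0 π))
    (hk : ContinuousOn k (Icc 0 π))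
    (hderiv : ∀ θ ∈ Ioo 0 π, HasDerivAt F (k θ * slitWeight θ) θ) :
    slitMean k = π⁻¹ * (F π - F 0) :=
  congrArg (π⁻¹ * ·)
    (integral_eq_sub_of_hasDerivAt_of_le pi_pos.le hF hderiv (intervalIntegrable_mul_slitWeight hk))

theorem slitMean_congr {k l : ℝ → ℝ} (h : ∀ θ ∈ Icc 0 π, k θ = l θ) : slitMean k = slitMean l := by
  unfold slitMean
  congr 1
  refine integral_congr fun θ hθ => ?_
  rw [uIcc_of_le pi_pos.le] at hθ
  simp only [h θ hθ]

theorem slitMean_add {k l : ℝ → ℝ} (hk : ContinuousOn k (Icc 0 π)) (hl : ContinuousOn l (Icc 0 π)) :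
    slitMean (fun θ => k θ + l θ) = slitMean k + slitMean l := by
  unfold slitMean
  rw [← mul_add, ← integral_add (intervalIntegrable_mul_slitWeight hk)
    (intervalIntegrable_mul_slitWeight hl)]
  simp only [add_mul]

theorem slitMean_const_mul (a : ℝ) (k : ℝ → ℝ) :
    slitMean (fun θ => a * k θ) = a * slitMean k := by
  unfold slitMean
  simp only [mul_assoc, intervalIntegral.integral_const_mul]
  ring

theorem continuousOn_slitMode_mul_slitRate_pow (x : ℝ) (n : ℕ) :
    ContinuousOn (fun θ => slitMode x θ * slitRate θ ^ n) (Icc 0 π) :=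
  (continuous_slitMode x).continuousOn.mul (continuousOn_slitRate.pow n)

theorem slitIntegral_harmonic (x : ℤ) (n : ℕ) :
    4 * slitIntegral x (n + 1) = slitIntegral (x - 1) n + slitIntegral (x + 1) n +
      slitIntegral (x - 1) (n + 2) + slitIntegral (x + 1) (n + 2) := by
  have hc := continuousOn_slitMode_mul_slitRate_pow
  unfold slitIntegral
  rw [← slitMean_add (hc _ _) (hc _ _), ← slitMean_add ((hc _ _).fun_add (hc _ _)) (hc _ _),
    ← slitMean_add (((hc _ _).fun_add (hc _ _)).fun_add (hc _ _)) (hc _ _), ← slitMean_const_mul]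
  refine slitMean_congr fun θ h => ?_
  have h1 := slitMode_add_one_add_slitMode_sub_one x θ
  have h2 := cos_mul_one_add_slitRate_sq h
  push_cast
  linear_combination -(1 + slitRate θ ^ 2) * slitRate θ ^ n * h1 -
    2 * slitMode x θ * slitRate θ ^ n * h2

/-- The current flowing out of the boundary site `x` in the integral representation. -/
noncomputable def slitCurrent (x : ℤ) : ℝ := slitMean fun θ => slitMode x θ * (2 * sin θ)

theorem slitIntegral_boundary (x : ℤ) :
    2 * slitIntegral x 0 = slitIntegral (x - 1) 1 + slitIntegral (x + 1) 1 + slitCurrent x := by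
  have hc := continuousOn_slitMode_mul_slitRate_pow
  have hs : ContinuousOn (fun θ => slitMode x θ * (2 * sin θ)) (Icc 0 π) :=
    (continuous_slitMode x).continuousOn.mul (by fun_prop)
  unfold slitIntegral slitCurrent
  rw [← slitMean_add (hc _ _) (hc _ _), ← slitMean_add ((hc _ _).fun_add (hc _ _)) hs,
    ← slitMean_const_mul]
  refine slitMean_congr fun θ h => ?_
  have h1 := slitMode_add_one_add_slitMode_sub_one x θ
  have h2 := slitRate_mul h
  have h3 := slitRate_sq h
  have h4 : cos θ * slitRate θ = 1 - sin θ := by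
    rw [← h2]; linear_combination h3
  push_cast
  linear_combination -slitRate θ * h1 - 2 * slitMode x θ * h4

theorem slitIntegral_zero_zero : slitIntegral 0 0 = 1 := by
  unfold slitIntegral
  rw [slitMean_eq_sub (F := fun θ => arcsin (√2 * sin ((0 + 1 / 2) * θ - π / 4))) (by fun_prop)
    (continuousOn_slitMode_mul_slitRate_pow _ _)]
  · have h1 : √2 * sin ((0 + 1 / 2) * π - π / 4) = 1 := by
      rw [show (0 + 1 / 2) * π - π / 4 = π / 4 by ring, sin_pi_div_four, ← mul_div_assoc,
        Real.mul_self_sqrt (by norm_num)]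
      norm_num
    have h2 : √2 * sin ((0 + 1 / 2) * 0 - π / 4) = -1 := by
      rw [show (0 + 1 / 2) * 0 - π / 4 = -(π / 4) by ring, sin_neg, sin_pi_div_four, mul_neg,
        ← mul_div_assoc, Real.mul_self_sqrt (by norm_num)]
      norm_num
    simp only [h1, h2, arcsin_one, arcsin_neg_one]
    field_simp
    norm_num
  · intro θ h
    simpa using hasDerivAt_arcsin_slit h

theorem slitMode_combination (x a b θ : ℝ) :
    (a + (x - 1 / 2) * b) * slitMode x θ + (a - (x - 1 / 2) * b) * slitMode (x - 2) θ =
      2 * (a * cos θ * cos ((x - 1 / 2) * θ - π / 4) -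
        b * ((x - 1 / 2) * sin θ * sin ((x - 1 / 2) * θ - π / 4))) := by
  unfold slitMode
  rw [show (x + 1 / 2) * θ - π / 4 = ((x - 1 / 2) * θ - π / 4) + θ by ring,
    show (x - 2 + 1 / 2) * θ - π / 4 = ((x - 1 / 2) * θ - π / 4) - θ by ring, cos_sub, cos_add]
  ring

theorem slitIntegral_boundary_rec (x : ℤ) :
    (x : ℝ) * slitIntegral x 0 = (x - 1) * slitIntegral (x - 2) 0 := by
  have hc := continuousOn_slitMode_mul_slitRate_pow
  suffices h : (x : ℝ) * slitIntegral x 0 + (1 - x) * slitIntegral (x - 2) 0 = 0 by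
    linear_combination h
  unfold slitIntegral
  rw [← slitMean_const_mul, ← slitMean_const_mul,
    ← slitMean_add ((hc _ _).const_mul _) ((hc _ _).const_mul _),
    slitMean_eq_sub (F := fun θ => √(2 * sin θ) * cos ((x - 1 / 2) * θ - π / 4)) (by fun_prop)
      (((hc _ _).const_mul _).fun_add ((hc _ _).const_mul _))]
  · simp
  · intro θ h
    refine ((hasDerivAt_sqrt_two_mul_sin h).mul
      (hasDerivAt_cos_linear (x - 1 / 2) (π / 4) θ)).congr_deriv ?_
    have h1 := slitMode_combination x (1 / 2) 1 θ
    rw [sqrt_eq_mul_slitWeight h]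
    push_cast
    linear_combination -slitWeight θ * h1

theorem slitCurrent_rec (x : ℤ) :
    (x + 1 : ℝ) * slitCurrent x = (x - 2) * slitCurrent (x - 2) := by
  have hc : ∀ y : ℝ, ContinuousOn (fun θ => slitMode y θ * (2 * sin θ)) (Icc 0 π) := fun y =>
    (continuous_slitMode y).continuousOn.mul (by fun_prop)
  suffices h : (x + 1 : ℝ) * slitCurrent x + (2 - x) * slitCurrent (x - 2) = 0 by
    linear_combination h
  unfold slitCurrent
  rw [← slitMean_const_mul, ← slitMean_const_mul,
    ← slitMean_add ((hc _).const_mul _) ((hc _).const_mul _),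
    slitMean_eq_sub (F := fun θ => 2 * sin θ * √(2 * sin θ) * cos ((x - 1 / 2) * θ - π / 4))
      (by fun_prop) (((hc _).const_mul _).fun_add ((hc _).const_mul _))]
  · simp
  · intro θ h
    refine ((((hasDerivAt_sin θ).const_mul 2).mul (hasDerivAt_sqrt_two_mul_sin h)).mul
      (hasDerivAt_cos_linear (x - 1 / 2) (π / 4) θ)).congr_deriv ?_
    have h1 := slitMode_combination x (3 / 2) 1 θ
    simp only [Pi.mul_apply]
    rw [sqrt_eq_mul_slitWeight h]
    push_cast
    linear_combination -2 * sin θ * slitWeight θ * h1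

theorem slitCurrent_zero : slitCurrent 0 = 1 := by
  rw [← slitIntegral_zero_zero]
  have hc := continuousOn_slitMode_mul_slitRate_pow
  have hs : ContinuousOn (fun θ => slitMode 0 θ * (2 * sin θ)) (Icc 0 π) :=
    (continuous_slitMode 0).continuousOn.mul (by fun_prop)
  suffices h : slitCurrent 0 + (-1) * slitIntegral 0 0 = 0 by linear_combination h
  unfold slitIntegral slitCurrent
  simp only [Int.cast_zero]
  rw [← slitMean_const_mul, ← slitMean_add hs ((hc _ _).const_mul _),
    slitMean_eq_sub (F := fun θ => √(2 * sin θ) * sin ((0 + 1 / 2) * θ - π / 4)) (by fun_prop)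
      (hs.fun_add ((hc _ _).const_mul _))]
  · simp
  · intro θ h
    refine ((hasDerivAt_sqrt_two_mul_sin h).mul
      (hasDerivAt_sin_linear (0 + 1 / 2) (π / 4) θ)).congr_deriv ?_
    have h' := Ioo_subset_Icc_self h
    have h1 : cos ((0 + 1 / 2) * θ - π / 4) = slitMode 0 θ := rfl
    have h2 := slitRate_mul h'
    have h3 := slitRate_sq h'
    rw [sqrt_eq_mul_slitWeight h, h1, sin_half_sub_pi_div_four h', ← h2]
    linear_combination -slitWeight θ * slitMode 0 θ * h3

theorem slitIntegral_neg_even (k : ℕ) : slitIntegral (-(2 * (k + 1))) 0 = 0 := by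
  induction k with
  | zero => simpa using slitIntegral_boundary_rec 0
  | succ k ih =>
    have h := slitIntegral_boundary_rec (-(2 * (k + 1)))
    rw [ih, mul_zero, show -(2 * ((k : ℤ) + 1)) - 2 = -(2 * ((k + 1 : ℕ) + 1)) by push_cast; ring]
      at h
    refine (mul_eq_zero.1 h.symm).resolve_left ?_
    push_cast
    have : (0 : ℝ) ≤ k := k.cast_nonneg
    linarith

theorem slitCurrent_pos_even (k : ℕ) : slitCurrent (2 * (k + 1)) = 0 := by
  induction k with
  | zero => simpa [show (2 : ℝ) + 1 ≠ 0 by norm_num] using slitCurrent_rec 2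
  | succ k ih =>
    have h := slitCurrent_rec (2 * ((k + 1 : ℕ) + 1))
    rw [show 2 * (((k + 1 : ℕ) : ℤ) + 1) - 2 = 2 * (k + 1) by push_cast; ring, ih, mul_zero] at h
    refine (mul_eq_zero.1 h).resolve_left ?_
    push_cast
    positivity

theorem slitIntegral_neg_one (n : ℕ) : slitIntegral (-1) n = slitIntegral 0 (n + 1) := by
  refine slitMean_congr fun θ h => ?_
  simp only [Int.reduceNeg, Int.cast_neg, Int.cast_one, Int.cast_zero]
  rw [slitMode_neg_one h]
  ring

/-- The integral representing consecutive sums `g (0, n) + g (0, n + 2)` along the vertical axis. -/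
noncomputable def slitAxis (n : ℕ) : ℝ := slitMean fun θ => (slitMode 0 θ)⁻¹ * slitRate θ ^ n

theorem continuousOn_inv_slitMode_mul_slitRate_pow (n : ℕ) :
    ContinuousOn (fun θ => (slitMode 0 θ)⁻¹ * slitRate θ ^ n) (Icc 0 π) :=
  ((continuous_slitMode 0).continuousOn.inv₀ fun _ h => (slitMode_zero_pos h).ne').mul
    (continuousOn_slitRate.pow n)

theorem slitIntegral_add_eq_slitAxis (n : ℕ) :
    slitIntegral 0 n + slitIntegral 0 (n + 2) = slitAxis n := by
  have hc := continuousOn_slitMode_mul_slitRate_pow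
  unfold slitIntegral slitAxis
  rw [← slitMean_add (hc _ _) (hc _ _)]
  refine slitMean_congr fun θ h => ?_
  simp only [Int.cast_zero]
  have h1 := slitMode_zero_pos h
  have h2 := slitMode_zero_sq θ
  have h3 := slitRate_sq h
  apply mul_left_cancel₀ h1.ne'
  rw [mul_inv_cancel_left₀ h1.ne']
  linear_combination slitRate θ ^ n * ((1 + slitRate θ ^ 2) * h2 + h3 / 2)

theorem hasDerivAt_inv_slitMode_zero {θ : ℝ} (h : θ ∈ Icc 0 π) :
    HasDerivAt (fun θ => (slitMode 0 θ)⁻¹) (-(slitRate θ / (2 * slitMode 0 θ))) θ := by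
  have h1 := slitMode_zero_pos h
  refine ((hasDerivAt_cos_linear (0 + 1 / 2) (π / 4) θ).inv h1.ne').congr_deriv ?_
  rw [sin_half_sub_pi_div_four h, show cos ((0 + 1 / 2) * θ - π / 4) = slitMode 0 θ from rfl]
  field_simp
  ring

theorem slitAxis_rec (n : ℕ) : (n + 2 : ℝ) * slitAxis (n + 2) = (n + 1) * slitAxis n := by
  have hc := continuousOn_inv_slitMode_mul_slitRate_pow
  suffices h : (n + 2 : ℝ) * slitAxis (n + 2) + (-(n + 1)) * slitAxis n = 0 by
    linear_combination h
  unfold slitAxis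
  rw [← slitMean_const_mul, ← slitMean_const_mul,
    ← slitMean_add ((hc _).const_mul _) ((hc _).const_mul _),
    slitMean_eq_sub
      (F := fun θ => √(2 * sin θ) * ((slitMode 0 θ)⁻¹ * slitRate θ ^ (n + 1)))
      (continuous_sqrt_two_mul_sin.continuousOn.mul (hc _))
      (((hc _).const_mul _).fun_add ((hc _).const_mul _))]
  · simp
  · intro θ h
    have h' := Ioo_subset_Icc_self h
    refine ((hasDerivAt_sqrt_two_mul_sin h).mul ((hasDerivAt_inv_slitMode_zero h').mul
      ((hasDerivAt_slitRate h').pow (n + 1)))).congr_deriv ?_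
    have h0 := one_add_sin_pos h'
    have h1 := slitMode_zero_pos h'
    have h2 := slitRate_mul h'
    have h3 := slitRate_sq h'
    simp only [Pi.mul_apply, Pi.pow_apply, Nat.add_sub_cancel]
    rw [sqrt_eq_mul_slitWeight h, ← h2]
    have h4 : 2 * sin θ * (1 + sin θ)⁻¹ = 1 - slitRate θ ^ 2 := by
      field_simp
      linear_combination h3
    push_cast
    linear_combination -((n : ℝ) + 1) * (slitMode 0 θ)⁻¹ * slitRate θ ^ n * slitWeight θ * h4

theorem sqrt_one_sub_slitRate_sq {θ : ℝ} (h : θ ∈ Ioo 0 π) :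
    √(1 - slitRate θ ^ 2) = √(2 * sin θ) / (√2 * slitMode 0 θ) := by
  have h' := Ioo_subset_Icc_self h
  have h0 := one_add_sin_pos h'
  have h1 := slitMode_zero_pos h'
  have h2 := sin_pos_of_mem_Ioo h
  rw [Real.sqrt_eq_iff_mul_self_eq_of_pos (by have := sqrt_two_mul_sin_pos h; positivity), ← sq,
    div_pow, mul_pow, Real.sq_sqrt (by positivity), Real.sq_sqrt (by norm_num),
    slitMode_zero_sq]
  field_simp
  linear_combination slitRate_sq h'

theorem slitAxis_zero : slitAxis 0 = √2 := by
  unfold slitAxis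
  rw [slitMean_eq_sub (F := fun θ => -√2 * arcsin (slitRate θ))
    ((continuous_arcsin.comp_continuousOn continuousOn_slitRate).const_mul _)
    (continuousOn_inv_slitMode_mul_slitRate_pow 0)]
  · simp only [slitRate, cos_pi, sin_pi, cos_zero, sin_zero, add_zero, div_one, arcsin_one,
      arcsin_neg_one]
    field_simp
    norm_num
  · intro θ h
    have h' := Ioo_subset_Icc_self h
    have h0 := one_add_sin_pos h'
    have h1 := slitMode_zero_pos h'
    have h2 := sqrt_two_mul_sin_pos h
    have h3 := abs_lt.1 (abs_slitRate_lt_one h)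
    refine (((hasDerivAt_arcsin h3.1.ne' h3.2.ne).comp θ
      (hasDerivAt_slitRate h')).const_mul (-√2)).congr_deriv ?_
    rw [sqrt_one_sub_slitRate_sq h]
    have h4 := slitMode_zero_sq θ
    have h5 : √2 ^ 2 = 2 := Real.sq_sqrt (by norm_num)
    have h6 : (1 + sin θ)⁻¹ = (2 * slitMode 0 θ ^ 2)⁻¹ := by
      rw [h4]; ring
    rw [h6]
    unfold slitWeight
    field_simp
    rw [h5]

theorem abs_slitIntegral_le (x : ℤ) (n : ℕ) :
    |slitIntegral x n| ≤ slitMean fun θ => |slitRate θ| ^ n := by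
  unfold slitIntegral slitMean
  rw [abs_mul, abs_of_pos (inv_pos.2 pi_pos)]
  refine mul_le_mul_of_nonneg_left ?_ (inv_pos.2 pi_pos).le
  refine (abs_integral_le_integral_abs pi_pos.le).trans
    (integral_mono_on pi_pos.le
      (intervalIntegrable_mul_slitWeight (continuousOn_slitMode_mul_slitRate_pow _ _)).abs
      (intervalIntegrable_mul_slitWeight (continuousOn_slitRate.abs.pow n)) fun θ _ => ?_)
  rw [abs_mul, abs_mul, abs_pow, abs_of_nonneg (a := slitWeight θ) (inv_nonneg.2 (sqrt_nonneg _))]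
  refine mul_le_mul_of_nonneg_right ?_ (inv_nonneg.2 (sqrt_nonneg _))
  exact mul_le_of_le_one_left (by positivity) (abs_cos_le_one _)

theorem tendsto_slitMean_abs_slitRate_pow :
    Tendsto (fun n : ℕ => slitMean fun θ => |slitRate θ| ^ n) atTop (𝓝 0) := by
  unfold slitMean
  suffices h : Tendsto (fun n : ℕ => ∫ θ in (0 : ℝ)..π, |slitRate θ| ^ n * slitWeight θ) atTop
      (𝓝 (∫ _ in (0 : ℝ)..π, (0 : ℝ))) by
    simpa using h.const_mul π⁻¹
  refine intervalIntegral.tendsto_integral_filter_of_dominated_convergence (l := atTop)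
    (F := fun (n : ℕ) θ => |slitRate θ| ^ n * slitWeight θ) slitWeight ?_ ?_
    intervalIntegrable_slitWeight ?_
  · refine Eventually.of_forall fun n => ?_
    rw [uIoc_of_le pi_pos.le]
    exact (intervalIntegrable_mul_slitWeight (continuousOn_slitRate.abs.pow n)).1.aestronglyMeasurable
  · refine Eventually.of_forall fun n => ?_
    have hne : ∀ᵐ θ : ℝ, θ ≠ π := by simp [ae_iff, measure_singleton]
    filter_upwards [hne] with θ hθ h
    rw [uIoc_of_le pi_pos.le] at h
    have h1 := abs_slitRate_lt_one ⟨h.1, lt_of_le_of_ne h.2 hθ⟩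
    have h2 : 0 ≤ slitWeight θ := inv_nonneg.2 (sqrt_nonneg _)
    rw [norm_mul, norm_pow, norm_eq_abs, abs_abs, norm_eq_abs, abs_of_nonneg h2]
    exact mul_le_of_le_one_left h2 (pow_le_one₀ (abs_nonneg _) h1.le)
  · have hne : ∀ᵐ θ : ℝ, θ ≠ π := by simp [ae_iff, measure_singleton]
    filter_upwards [hne] with θ hθ h
    rw [uIoc_of_le pi_pos.le] at h
    have h1 := abs_slitRate_lt_one ⟨h.1, lt_of_le_of_ne h.2 hθ⟩
    simpa using (tendsto_pow_atTop_nhds_zero_of_lt_one (abs_nonneg _) h1).mul_const (slitWeight θ)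

theorem tendsto_slitIntegral_cofinite (n : ℕ) :
    Tendsto (fun x : ℤ => slitIntegral x n) cofinite (𝓝 0) := by
  set f : ℝ → ℂ := (Ioc 0 π).indicator fun θ =>
    Complex.exp (Complex.I * ((1 / 2 * θ - π / 4 : ℝ) : ℂ)) *
      ((slitRate θ ^ n * slitWeight θ : ℝ) : ℂ) with hf
  have hRL := Real.tendsto_integral_exp_smul_cocompact f
  have hcast : Tendsto (fun x : ℤ => (-(x : ℝ) / (2 * π))) cofinite (cocompact ℝ) := by
    have h1 : Tendsto (fun x : ℤ => (x : ℝ)) cofinite (cocompact ℝ) :=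
      Int.tendsto_coe_cofinite
    have h2 := (Homeomorph.mulRight₀ (-(2 * π)⁻¹)
      (by simp [pi_ne_zero])).isClosedEmbedding.tendsto_cocompact.comp h1
    refine h2.congr fun x => ?_
    simp [div_eq_mul_inv]
  have hre := (Complex.continuous_re.tendsto 0).comp (hRL.comp hcast)
  have hlim := hre.const_mul π⁻¹
  rw [Complex.zero_re, mul_zero] at hlim
  refine hlim.congr fun x => ?_
  simp only [Function.comp_apply]
  unfold slitIntegral slitMean
  congr 1
  have hf1 := intervalIntegrable_mul_slitWeight (continuousOn_slitRate.pow n)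
  have hexp : Continuous fun θ : ℝ =>
    Complex.exp (Complex.I * (((x + 1 / 2) * θ - π / 4 : ℝ) : ℂ)) := by fun_prop
  have hf2 : IntervalIntegrable (fun θ : ℝ =>
      Complex.exp (Complex.I * (((x + 1 / 2) * θ - π / 4 : ℝ) : ℂ)) *
        ((slitRate θ ^ n * slitWeight θ : ℝ) : ℂ)) volume 0 π :=
    IntervalIntegrable.continuousOn_mul ⟨hf1.1.ofReal, hf1.2.ofReal⟩ hexp.continuousOn
  have hEq : (∫ v : ℝ, Real.fourierChar (-(v * (-(x : ℝ) / (2 * π)))) • f v) =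
      ∫ θ in (0 : ℝ)..π, Complex.exp (Complex.I * (((x + 1 / 2) * θ - π / 4 : ℝ) : ℂ)) *
        ((slitRate θ ^ n * slitWeight θ : ℝ) : ℂ) := by
    rw [intervalIntegral.integral_of_le pi_pos.le, ← MeasureTheory.integral_indicator measurableSet_Ioc]
    refine integral_congr_ae (Eventually.of_forall fun θ => ?_)
    simp only [hf, indicator_apply]
    split_ifs
    · rw [Circle.smul_def, Real.fourierChar_apply, smul_eq_mul, ← mul_assoc, ← Complex.exp_add]
      congr 2
      have : (π : ℂ) ≠ 0 := by exact_mod_cast pi_ne_zero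
      push_cast
      field_simp
      ring
    · simp
  rw [hEq]
  have hreint := Complex.reCLM.intervalIntegral_comp_comm hf2
  rw [Complex.reCLM_apply] at hreint
  rw [← hreint]
  refine integral_congr fun θ _ => ?_
  simp only [Complex.reCLM_apply, Complex.re_mul_ofReal]
  rw [mul_comm Complex.I, Complex.exp_ofReal_mul_I_re, slitMode]
  ring

theorem finite_le_abs_slitIntegral {ε : ℝ} (hε : 0 < ε) :
    {p : ℤ × ℕ | ε ≤ |slitIntegral p.1 p.2|}.Finite := by
  obtain ⟨N, hN⟩ := eventually_atTop.1
    (tendsto_slitMean_abs_slitRate_pow.eventually (gt_mem_nhds hε))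
  have hrow : ∀ n : ℕ, {x : ℤ | ε ≤ |slitIntegral x n|}.Finite := by
    intro n
    have h := (tendsto_slitIntegral_cofinite n).abs.eventually
      (gt_mem_nhds (by simpa using hε))
    rw [eventually_cofinite] at h
    simpa using h
  refine ((Set.finite_Iio N).biUnion fun n _ =>
    (hrow n).image fun x => (x, n)).subset fun p hp => ?_
  simp only [mem_iUnion, Set.mem_image]
  refine ⟨p.2, ?_, p.1, hp, rfl⟩
  by_contra! h
  exact absurd (hp.trans (abs_slitIntegral_le p.1 p.2)) (not_le.2 (hN p.2 (by simpa using h)))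

theorem eq_zero_of_harmonic_of_finite {d : ℤ → ℕ → ℝ}
    (h_inner : ∀ (x : ℤ) (n : ℕ), Even (x + n + 1) →
      4 * d x (n + 1) = d (x - 1) n + d (x + 1) n + d (x - 1) (n + 2) + d (x + 1) (n + 2))
    (hpos : ∀ x : ℤ, 0 ≤ x → Even x → 2 * d x 0 = d (x - 1) 1 + d (x + 1) 1)
    (hneg : ∀ x : ℤ, x < 0 → Even x → d x 0 = 0)
    (hfin : ∀ ε : ℝ, 0 < ε → {p : ℤ × ℕ | ε ≤ |d p.1 p.2|}.Finite)
    {x : ℤ} {n : ℕ} (hxn : Even (x + n)) : d x n = 0 := by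
  apply le_antisymm
  · exact nonpos_of_subharmonic_of_finite (fun x n h => (h_inner x n h).le)
      (fun x h h' => (hpos x h h').le) (fun x h h' => (hneg x h h').le)
      (fun ε hε => (hfin ε hε).subset fun p (hp : ε ≤ _) => hp.trans (le_abs_self _)) hxn
  · rw [← neg_nonpos]
    exact nonpos_of_subharmonic_of_finite (d := fun x n => -d x n)
      (fun x n h => by linarith [h_inner x n h]) (fun x h h' => by linarith [hpos x h h'])
      (fun x h h' => by linarith [hneg x h h'])
      (fun ε hε => (hfin ε hε).subset fun p (hp : ε ≤ _) => hp.trans (neg_le_abs _)) hxn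

theorem IsSlitGreen.finite_le_abs {g : ℤ × ℤ → ℝ} (hg : IsSlitGreen g) {ε : ℝ} (hε : 0 < ε) :
    {p : ℤ × ℕ | ε ≤ |g (p.1, (p.2 : ℤ))|}.Finite := by
  obtain ⟨N, hN⟩ := hg.2.2.2.2.2.2 ε hε
  refine ((Set.finite_Icc (-(N : ℤ)) N).prod (Set.finite_Iic N)).subset fun p hp => ?_
  have h : |p.1| + |(p.2 : ℤ)| < N := by
    by_contra! h
    exact absurd (hN _ _ h) (not_lt.2 hp)
  rw [abs_of_nonneg (Int.natCast_nonneg p.2)] at h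
  have := abs_nonneg p.1
  exact ⟨abs_le.1 (by omega), Set.mem_Iic.2 (by omega)⟩

theorem IsSlitGreen.eq_slitIntegral {g : ℤ × ℤ → ℝ} (hg : IsSlitGreen g) {x : ℤ} {n : ℕ}
    (hxn : Even (x + n)) : g (x, (n : ℤ)) = slitIntegral x n := by
  obtain ⟨-, hdir, hharm, hrefl, hsource, -, -⟩ := id hg
  refine sub_eq_zero.1 (eq_zero_of_harmonic_of_finite
    (d := fun (x : ℤ) (n : ℕ) => g (x, (n : ℤ)) - slitIntegral x n) ?_ ?_ ?_ ?_ hxn)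
  · intro x n h
    have h1 := hharm x (n + 1) (by omega) (by rwa [← add_assoc])
    rw [show (n : ℤ) + 1 - 1 = n by ring, show (n : ℤ) + 1 + 1 = n + 2 by ring] at h1
    have h2 := slitIntegral_harmonic x n
    push_cast
    linarith
  · intro x h h'
    have h2 := slitIntegral_boundary x
    rcases h.eq_or_lt with rfl | h
    · have h3 := slitCurrent_zero
      simp only [zero_sub, zero_add, Nat.cast_zero, Nat.cast_one] at h2 ⊢
      linarith
    · have h1 := hrefl x h h'
      obtain ⟨k, rfl⟩ : ∃ k : ℕ, x = 2 * (k + 1) := by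
        obtain ⟨r, hr⟩ := h'
        exact ⟨(r - 1).toNat, by omega⟩
      have h3 := slitCurrent_pos_even k
      simp only [Nat.cast_zero, Nat.cast_one]
      linarith
  · intro x h h'
    obtain ⟨k, rfl⟩ : ∃ k : ℕ, x = -(2 * (k + 1)) := by
      obtain ⟨r, hr⟩ := h'
      exact ⟨(-r - 1).toNat, by omega⟩
    simp only [Nat.cast_zero]
    rw [slitIntegral_neg_even, hdir _ h, sub_zero]
  · intro ε hε
    refine ((hg.finite_le_abs (half_pos hε)).union
      (finite_le_abs_slitIntegral (half_pos hε))).subset fun p hp => ?_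
    by_contra! h
    simp only [mem_union, mem_ofPred_eq, not_or, not_le] at h hp
    linarith [abs_sub (g (p.1, (p.2 : ℤ))) (slitIntegral p.1 p.2)]

theorem hasSum_of_even_of_odd_eq_zero {a : ℕ → ℝ} {u s : ℝ} (hodd : ∀ k, a (2 * k + 1) = 0)
    (h : HasSum (fun k => a (2 * k) * (u ^ 2) ^ k) s) : HasSum (fun n => a n * u ^ n) s := by
  rw [← add_zero s]
  refine HasSum.even_add_odd (by simpa only [pow_mul] using h) ?_
  simp only [hodd, zero_mul]
  exact hasSum_zero

theorem hasSum_slitAxis {w : ℝ} (hw : 0 < w) (hw' : w < 1) :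
    HasSum (fun k => slitAxis (2 * k) * (w ^ 2) ^ k) (√2 / √(1 - w ^ 2)) := by
  have h := hasSum_of_binomial_recurrence (a := -(1 / 2)) (t := w ^ 2)
    (c := fun k => slitAxis (2 * k)) (by rw [abs_pow, abs_of_pos hw]; nlinarith) fun k => by
      have := slitAxis_rec (2 * k)
      push_cast at this
      rw [show 2 * k + 2 = 2 * (k + 1) by ring] at this
      linear_combination this / 2
  rw [Real.rpow_neg (by nlinarith), ← Real.sqrt_eq_rpow, mul_zero, slitAxis_zero] at h
  rwa [div_eq_mul_inv]

theorem hasSum_slitCurrent {u : ℝ} (hu : 0 < u) (hu' : u < 1) :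
    HasSum (fun k : ℕ => slitCurrent (-(2 * k)) * (u ^ 2) ^ k) √(1 - u ^ 2) := by
  have h := hasSum_of_binomial_recurrence (a := 1 / 2) (t := u ^ 2)
    (c := fun k => slitCurrent (-(2 * k))) (by rw [abs_pow, abs_of_pos hu]; nlinarith) fun k => by
      have := slitCurrent_rec (-(2 * k))
      push_cast at this
      rw [show -(2 * (k : ℤ)) - 2 = -(2 * (k + 1 : ℕ)) by push_cast; ring] at this
      linear_combination this / 2
  rw [← Real.sqrt_eq_rpow] at h
  simpa [slitCurrent_zero] using h

theorem IsSlitGreen.apply_eq_zero {g : ℤ × ℤ → ℝ} (hg : IsSlitGreen g) {x y : ℤ}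
    (h : Odd (x + y)) : g (x, y) = 0 := hg.1 x y (.inr h)

theorem IsSlitGreen.hasSum_axis {g : ℤ × ℤ → ℝ} (hg : IsSlitGreen g) {w : ℝ} (hw : 0 < w)
    (hw' : w < 1) :
    HasSum (fun n : ℕ => (g (0, (n : ℤ)) + g (0, (n : ℤ) + 2)) * w ^ n) (√2 / √(1 - w ^ 2)) := by
  refine hasSum_of_even_of_odd_eq_zero (a := fun n : ℕ => g (0, (n : ℤ)) + g (0, (n : ℤ) + 2))
    (fun k => ?_) ?_
  · rw [hg.apply_eq_zero (by push_cast; grind), hg.apply_eq_zero (by push_cast; grind), add_zero]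
  · refine (hasSum_slitAxis hw hw').congr_fun fun k => ?_
    have h1 := hg.eq_slitIntegral (x := 0) (n := 2 * k) (by push_cast; grind)
    have h2 := hg.eq_slitIntegral (x := 0) (n := 2 * k + 2) (by push_cast; grind)
    rw [← slitIntegral_add_eq_slitAxis, ← h1, ← h2]
    push_cast
    rfl

theorem IsSlitGreen.apply_neg_one {g : ℤ × ℤ → ℝ} (hg : IsSlitGreen g) (n : ℕ) :
    g (-1, (n : ℤ)) = g (0, (n : ℤ) + 1) := by
  rcases Int.even_or_odd (-1 + (n : ℤ)) with h | h
  · have h2 := hg.eq_slitIntegral (x := 0) (n := n + 1) (by push_cast; grind)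
    rw [hg.eq_slitIntegral h, slitIntegral_neg_one, ← h2]
    push_cast
    rfl
  · rw [hg.apply_eq_zero h, hg.apply_eq_zero (by grind)]

theorem IsSlitGreen.hasSum_current {g : ℤ × ℤ → ℝ} (hg : IsSlitGreen g) {u : ℝ} (hu : 0 < u)
    (hu' : u < 1) :
    HasSum (fun m : ℕ => (g (-((m : ℤ) + 1) - 1, 1) + g (-((m : ℤ) + 1) + 1, 1)) * u ^ (m + 1))
      (1 - √(1 - u ^ 2)) := by
  have h := (hasSum_of_even_of_odd_eq_zero (u := u)
    (a := fun n : ℕ => if Even n then slitCurrent (-n) else 0) (s := √(1 - u ^ 2))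
    (fun k => if_neg (by simp)) (by simpa using hasSum_slitCurrent hu hu'))
  have h1 := ((hasSum_nat_add_iff' 1).2 h).neg
  simp only [Finset.sum_range_one, Even.zero, if_true, Nat.cast_zero, neg_zero, slitCurrent_zero,
    pow_zero, mul_one, neg_sub] at h1
  refine h1.congr_fun fun m => ?_
  split_ifs with hm
  · have h2 := slitIntegral_boundary (-((m : ℤ) + 1))
    have h3 := hg.eq_slitIntegral (x := -((m : ℤ) + 1)) (n := 0)
      (by rw [← Int.even_coe_nat] at hm; push_cast at hm ⊢; grind)
    have h4 := hg.eq_slitIntegral (x := -((m : ℤ) + 1) - 1) (n := 1)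
      (by rw [← Int.even_coe_nat] at hm; push_cast at hm ⊢; grind)
    have h5 := hg.eq_slitIntegral (x := -((m : ℤ) + 1) + 1) (n := 1)
      (by rw [← Int.even_coe_nat] at hm; push_cast at hm ⊢; grind)
    have h6 := hg.2.1 (-((m : ℤ) + 1)) (by omega)
    push_cast at h3 h4 h5 ⊢
    rw [h4, h5]
    rw [← h3, h6] at h2
    linear_combination -u ^ (m + 1) * h2
  · rw [← Int.even_coe_nat] at hm
    push_cast at hm
    rw [hg.apply_eq_zero (by grind), hg.apply_eq_zero (by grind)]
    simp

theorem hasSum_row_shift_left {a : ℤ → ℝ} {u s : ℝ} (hu : u ≠ 0)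
    (h : HasSum (fun m : ℕ => a (-((m : ℤ) + 1)) * u ^ (m + 1)) s) :
    HasSum (fun m : ℕ => a (-((m : ℤ) + 1) - 1) * u ^ (m + 1)) (s / u - a (-1)) := by
  have h1 := ((hasSum_nat_add_iff' 1).2 h).div_const u
  simp only [Finset.sum_range_one, Nat.cast_zero, zero_add, pow_one] at h1
  rw [sub_div, mul_div_cancel_right₀ _ hu] at h1
  refine h1.congr_fun fun m => ?_
  rw [pow_succ u (m + 1), ← mul_assoc, mul_div_cancel_right₀ _ hu]
  congr 2

theorem hasSum_row_shift_right {a : ℤ → ℝ} {u s : ℝ}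
    (h : HasSum (fun m : ℕ => a (-((m : ℤ) + 1)) * u ^ (m + 1)) s) :
    HasSum (fun m : ℕ => a (-((m : ℤ) + 1) + 1) * u ^ (m + 1)) (u * (a 0 + s)) := by
  have h1 : HasSum (fun m : ℕ => a (-(m : ℤ)) * u ^ m) (s + a 0) := by
    have := (hasSum_nat_add_iff (f := fun m : ℕ => a (-(m : ℤ)) * u ^ m) 1).1
      (by simpa using h)
    simpa using this
  rw [add_comm s] at h1
  refine (h1.mul_left u).congr_fun fun m => ?_
  rw [show -((m : ℤ) + 1) + 1 = -(m : ℤ) by ring]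
  ring

theorem kernel_neg {z w : ℝ} (hz : 1 < z) (hw : 0 < w) (hw' : w < 1) :
    4 - w / z - z / w - z * w - 1 / (z * w) < 0 := by
  have hz0 : 0 < z := by linarith
  have h : 4 - w / z - z / w - z * w - 1 / (z * w) =
      (4 * (z * w) - (1 + z ^ 2) * (1 + w ^ 2)) / (z * w) := by
    field_simp
    ring
  rw [h]
  refine div_neg_of_neg_of_pos ?_ (by positivity)
  nlinarith [sq_pos_of_pos (sub_pos.2 hz), sq_nonneg (z * w - 1), sq_nonneg (z - w)]

theorem IsSlitGreen.summable_quadrant {g : ℤ × ℤ → ℝ} (hg : IsSlitGreen g) {u w : ℝ} (hu : 0 < u)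
    (hu' : u < 1) (hw : 0 < w) (hw' : w < 1) :
    Summable fun p : ℕ × ℕ => g (-((p.2 : ℤ) + 1), (p.1 : ℤ)) * u ^ (p.2 + 1) * w ^ p.1 := by
  have h1 := summable_geometric_of_lt_one hw.le hw'
  have h2 := (summable_geometric_of_lt_one hu.le hu').mul_right u
  refine Summable.of_nonneg_of_le (fun p => ?_) (fun p => ?_)
    (h1.mul_of_nonneg h2 (fun _ => by positivity) fun _ => by positivity)
  · have := (hg.2.2.2.2.2.1 (-((p.2 : ℤ) + 1)) p.1).1
    positivity
  · have := (hg.2.2.2.2.2.1 (-((p.2 : ℤ) + 1)) p.1).2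
    have h3 : 0 ≤ u ^ (p.2 + 1) * w ^ p.1 := by positivity
    calc _ = g (-((p.2 : ℤ) + 1), (p.1 : ℤ)) * (u ^ (p.2 + 1) * w ^ p.1) := by ring
      _ ≤ 1 * (u ^ (p.2 + 1) * w ^ p.1) := mul_le_mul_of_nonneg_right this h3
      _ = _ := by ring

theorem IsSlitGreen.summable_row {g : ℤ × ℤ → ℝ} (hg : IsSlitGreen g) {u : ℝ} (hu : 0 < u)
    (hu' : u < 1) (n : ℕ) :
    Summable fun m : ℕ => g (-((m : ℤ) + 1), (n : ℤ)) * u ^ (m + 1) := by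
  refine Summable.of_nonneg_of_le (fun m => ?_) (fun m => ?_)
    ((summable_geometric_of_lt_one hu.le hu').mul_right u)
  · have := (hg.2.2.2.2.2.1 (-((m : ℤ) + 1)) n).1
    positivity
  · have := (hg.2.2.2.2.2.1 (-((m : ℤ) + 1)) n).2
    rw [← pow_succ]
    exact mul_le_of_le_one_left (by positivity) this

/-- The generating function of the row of height `n` on the negative side. -/
noncomputable def rowSum (g : ℤ × ℤ → ℝ) (u : ℝ) (n : ℕ) : ℝ :=
  ∑' m : ℕ, g (-((m : ℤ) + 1), (n : ℤ)) * u ^ (m + 1)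

theorem IsSlitGreen.harmonic {g : ℤ × ℤ → ℝ} (hg : IsSlitGreen g) (x : ℤ) (n : ℕ) :
    4 * g (x, (n : ℤ) + 1) =
      g (x - 1, (n : ℤ)) + g (x + 1, (n : ℤ)) + g (x - 1, (n : ℤ) + 2) + g (x + 1, (n : ℤ) + 2) := by
  rcases Int.even_or_odd (x + ((n : ℤ) + 1)) with h | h
  · have := hg.2.2.1 x (n + 1) (by omega) h
    rwa [add_sub_cancel_right, add_assoc (n : ℤ) 1 1] at this
  · rw [hg.apply_eq_zero h, hg.apply_eq_zero (by grind), hg.apply_eq_zero (by grind),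
      hg.apply_eq_zero (by grind), hg.apply_eq_zero (by grind)]
    simp

theorem IsSlitGreen.rowSum_harmonic {g : ℤ × ℤ → ℝ} (hg : IsSlitGreen g) {u : ℝ} (hu : 0 < u)
    (hu' : u < 1) (n : ℕ) :
    4 * rowSum g u (n + 1) = (u + 1 / u) * (rowSum g u n + rowSum g u (n + 2)) -
      (g (0, (n : ℤ) + 1) + g (0, (n : ℤ) + 1 + 2)) + u * (g (0, (n : ℤ)) + g (0, (n : ℤ) + 2)) := by
  have hrow := fun n => (hg.summable_row hu hu' n).hasSum
  have hL := fun n : ℕ => hasSum_row_shift_left (a := fun x => g (x, (n : ℤ))) hu.ne' (hrow n)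
  have hR := fun n : ℕ => hasSum_row_shift_right (a := fun x => g (x, (n : ℤ))) (hrow n)
  have h1 := (((hL n).add (hR n)).add (hL (n + 2))).add (hR (n + 2))
  have h2 := (hrow (n + 1)).mul_left 4
  have h3 := h2.unique (h1.congr_fun fun m => by
    have := hg.harmonic (-((m : ℤ) + 1)) n
    push_cast
    linear_combination u ^ (m + 1) * this)
  have e1 := hg.apply_neg_one n
  have e2 := hg.apply_neg_one (n + 2)
  unfold rowSum
  push_cast at h3 e2 ⊢
  rw [h3, e1, e2, show (n : ℤ) + 1 + 2 = n + 2 + 1 by ring]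
  ring

theorem IsSlitGreen.apply_zero_zero {g : ℤ × ℤ → ℝ} (hg : IsSlitGreen g) : g (0, 0) = 1 := by
  have := hg.eq_slitIntegral (x := 0) (n := 0) (by simp)
  rwa [slitIntegral_zero_zero] at this

theorem IsSlitGreen.apply_axis_add {g : ℤ × ℤ → ℝ} (hg : IsSlitGreen g) :
    g (0, 0) + g (0, 2) = √2 := by
  have h1 := hg.eq_slitIntegral (x := 0) (n := 0) (by simp)
  have h2 := hg.eq_slitIntegral (x := 0) (n := 2) (by simp)
  rw [← slitAxis_zero, ← slitIntegral_add_eq_slitAxis, ← h1, ← h2]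
  rfl

theorem IsSlitGreen.rowSum_one {g : ℤ × ℤ → ℝ} (hg : IsSlitGreen g) {u : ℝ} (hu : 0 < u)
    (hu' : u < 1) : (u + 1 / u) * rowSum g u 1 = √2 - √(1 - u ^ 2) := by
  have hrow := (hg.summable_row hu hu' 1).hasSum
  have h1 := (hasSum_row_shift_left (a := fun x => g (x, ((1 : ℕ) : ℤ))) hu.ne' hrow).add
    (hasSum_row_shift_right (a := fun x => g (x, ((1 : ℕ) : ℤ))) hrow)
  have h2 := h1.unique ((hg.hasSum_current hu hu').congr_fun fun m => by
    push_cast; ring)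
  have e1 := hg.apply_neg_one 1
  have e2 := hg.apply_axis_add
  have e3 := hg.apply_zero_zero
  have e4 : g (0, 1) = 0 := hg.apply_eq_zero (by simp)
  unfold rowSum
  push_cast at h2 e1 ⊢
  rw [e1, e4] at h2
  linear_combination h2 + e2 - e3

theorem IsSlitGreen.hasSum_quadrant {g : ℤ × ℤ → ℝ} (hg : IsSlitGreen g) {u w : ℝ} (hu : 0 < u)
    (hu' : u < 1) (hw : 0 < w) (hw' : w < 1) :
    ∃ q : ℝ, HasSum
        (fun p : ℕ × ℕ => g (-((p.2 : ℤ) + 1), (p.1 : ℤ)) * u ^ (p.2 + 1) * w ^ p.1) q ∧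
      (4 - (u + 1 / u) * (w + 1 / w)) * q = √2 * (w * u - 1) / √(1 - w ^ 2) + √(1 - u ^ 2) := by
  refine ⟨_, (hg.summable_quadrant hu hu' hw hw').hasSum, ?_⟩
  generalize hq : ∑' p : ℕ × ℕ, g (-((p.2 : ℤ) + 1), (p.1 : ℤ)) * u ^ (p.2 + 1) * w ^ p.1 = q
  have hQ : HasSum (fun n => rowSum g u n * w ^ n) q := by
    rw [← hq]
    exact (hg.summable_quadrant hu hu' hw hw').hasSum.prod_fiberwise fun n =>
      (hg.summable_row hu hu' n).hasSum.mul_right _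
  have hrow0 : rowSum g u 0 = 0 := by
    unfold rowSum
    refine (tsum_congr fun m => ?_).trans tsum_zero
    rw [Nat.cast_zero, hg.2.1 _ (by omega), zero_mul]
  have hF := hg.hasSum_axis hw hw'
  have hQ1 := (hasSum_nat_add_iff' 1).2 hQ
  have hQ2 := ((hasSum_nat_add_iff' 2).2 hQ).div_const w
  have hF1 := (hasSum_nat_add_iff' 1).2 hF
  have h1 := ((((hQ.mul_left w).add hQ2).mul_left (u + 1 / u)).sub hF1).add (hF.mul_left (u * w))
  have h2 := (hQ1.mul_left 4).unique (h1.congr_fun fun n => by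
    have := hg.rowSum_harmonic hu hu' n
    rw [show w ^ (n + 2) = w ^ (n + 1) * w by ring, ← mul_assoc (rowSum g u (n + 2)),
      mul_div_cancel_right₀ _ hw.ne']
    push_cast
    linear_combination w ^ (n + 1) * this)
  simp only [Finset.sum_range_succ, Finset.sum_range_zero, hrow0,
    Nat.cast_zero, zero_add, pow_zero, pow_one, mul_one, sub_zero, hg.apply_axis_add] at h2
  have h3 := hg.rowSum_one hu hu'
  rw [sub_div, mul_div_cancel_right₀ _ hw.ne'] at h2
  linear_combination h2 - h3

/-- Second-quadrant generating function of the slit-plane Green's function. -/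
theorem slitGreen_quadrant_gf_NW (g : ℤ × ℤ → ℝ) (hg : IsSlitGreen g) :
    ∀ z w : ℝ, 1 < z → 0 < w → w < 1 →
      (4 - w / z - z / w - z * w - 1 / (z * w) ≠ 0) ∧
      HasSum
        (fun p : ℕ × ℕ =>
          g (-((p.1 : ℤ) + 1), (p.2 : ℤ)) * z ^ (-((p.1 : ℤ) + 1)) * w ^ p.2)
        ((Real.sqrt 2 * (w / z - 1) / Real.sqrt (1 - w ^ 2) +
            Real.sqrt (1 - 1 / z ^ 2)) /
          (4 - w / z - z / w - z * w - 1 / (z * w))) := by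
  intro z w hz hw hw'
  have hK := (kernel_neg hz hw hw').ne
  refine ⟨hK, ?_⟩
  have hz0 : 0 < z := by linarith
  obtain ⟨q, hq, hKq⟩ := hg.hasSum_quadrant (inv_pos.2 hz0) (inv_lt_one_of_one_lt₀ hz) hw hw'
  have hKq' : q * (4 - w / z - z / w - z * w - 1 / (z * w)) =
      Real.sqrt 2 * (w / z - 1) / Real.sqrt (1 - w ^ 2) + Real.sqrt (1 - 1 / z ^ 2) := by
    rw [div_eq_mul_inv w z, one_div (z ^ 2), ← inv_pow, ← hKq]
    field_simp
    ring
  rw [← hKq', mul_div_cancel_right₀ _ hK]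
  refine ((Equiv.prodComm ℕ ℕ).hasSum_iff.2 hq).congr_fun fun p => ?_
  simp only [Function.comp_apply, Equiv.prodComm_apply, Prod.fst_swap, Prod.snd_swap]
  rw [zpow_neg, ← inv_zpow]
  norm_cast
end

section
/- There exists exactly one bounded function h : ℤ² → ℝ such that h = 0 on R, h(v) → 0 as |v| → ∞, and for every v ∉ R, 4·h(v) − ∑_{v' adjacent to v} h(v') equals 1 if v = (0,0) and equals 0 otherwise; moreover this h satisfies h((0,0)) = √2 − 1. (This is the diagonal value at the source of the Green's function of ℤ² with Dirichlet boundary on the horizontal ray R, the constant appearing in the geometric-runs theorem for the spanning tree trunk.) -/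
/-- `h` is the Green's function of the square lattice `ℤ²` with Dirichlet boundary on
the negative horizontal ray `R = {(x,0) : x ≤ -1}` and source at the origin:
`h` is bounded, vanishes on `R`, tends to `0` at infinity, and
`4·h(v) - ∑_{v' ~ v} h(v')` is `1` at the origin and `0` at every other vertex
off `R`. -/
def IsRayGreen (h : ℤ × ℤ → ℝ) : Prop :=
  (∃ C : ℝ, ∀ v : ℤ × ℤ, |h v| ≤ C) ∧
  (∀ v : ℤ × ℤ, (v.2 = 0 ∧ v.1 ≤ -1) → h v = 0) ∧
  Filter.Tendsto h Filter.cofinite (nhds 0) ∧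
  (∀ v : ℤ × ℤ, ¬(v.2 = 0 ∧ v.1 ≤ -1) →
    4 * h v - (h (v.1 + 1, v.2) + h (v.1 - 1, v.2) + h (v.1, v.2 + 1) + h (v.1, v.2 - 1)) =
      if v = (0, 0) then 1 else 0)

open Real Filter Topology MeasureTheory Set Metric
open scoped ComplexConjugate

namespace RayGreen

lemma norm_one_sub_circleMap_ge {ρ θ : ℝ} (hρ : 0 ≤ ρ) (hρ' : ρ ≤ 1) (hθ : |θ| ≤ π) :
    |θ| / π ≤ ‖1 - circleMap 0 ρ θ‖ := by
  have hunit : 2 * (|θ| / π) ≤ ‖1 - circleMap 0 1 θ‖ := by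
    have h := mul_abs_le_abs_sin (x := θ / 2) (by rw [abs_div, abs_two]; linarith)
    rw [norm_sub_rev, show circleMap 0 1 θ = Complex.exp (Complex.I * θ) by
      simp [circleMap, mul_comm], Complex.norm_exp_I_mul_ofReal_sub_one, norm_mul, norm_eq_abs,
      norm_eq_abs, abs_two]
    rw [abs_div, abs_two] at h
    calc 2 * (|θ| / π) = 2 * (2 / π * (|θ| / 2)) := by ring
      _ ≤ _ := by gcongr
  have hdiff : ‖circleMap 0 ρ θ - circleMap 0 1 θ‖ = 1 - ρ := by
    have : circleMap 0 ρ θ - circleMap 0 1 θ = ((ρ - 1 : ℝ) : ℂ) * circleMap 0 1 θ := by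
      simp [circleMap]; ring
    rw [this, norm_mul, norm_circleMap_zero, Complex.norm_real, norm_eq_abs, abs_one, mul_one,
      abs_of_nonpos (by linarith)]
    ring
  have htri : ‖1 - circleMap 0 1 θ‖ ≤
      ‖1 - circleMap 0 ρ θ‖ + ‖circleMap 0 ρ θ - circleMap 0 1 θ‖ := by
    simpa using norm_add_le (1 - circleMap 0 ρ θ) (circleMap 0 ρ θ - circleMap 0 1 θ)
  have hone : 1 - ρ ≤ ‖1 - circleMap 0 ρ θ‖ := by
    have := norm_sub_norm_le (1 : ℂ) (circleMap 0 ρ θ)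
    rwa [norm_one, norm_circleMap_zero, abs_of_nonneg hρ] at this
  linarith

lemma norm_one_sub_circleMap_rpow_le {ρ θ : ℝ} (hρ : 0 ≤ ρ) (hρ' : ρ ≤ 1) (hθ : |θ| ≤ π)
    (hθ0 : θ ≠ 0) :
    ‖1 - circleMap 0 ρ θ‖ ^ (-(1 / 2) : ℝ) ≤ (|θ| / π) ^ (-(1 / 2) : ℝ) :=
  rpow_le_rpow_of_nonpos (by positivity) (norm_one_sub_circleMap_ge hρ hρ' hθ) (by norm_num)

lemma intervalIntegrable_abs_div_pi_rpow :
    IntervalIntegrable (fun θ : ℝ => (|θ| / π) ^ (-(1 / 2) : ℝ)) volume (-π) π := by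
  have hpos : IntervalIntegrable (fun θ : ℝ => (|θ| / π) ^ (-(1 / 2) : ℝ)) volume 0 π := by
    have h : IntervalIntegrable (fun θ : ℝ => θ ^ (-(1 / 2) : ℝ) * (π⁻¹) ^ (-(1 / 2) : ℝ))
        volume 0 π := (intervalIntegral.intervalIntegrable_rpow' (by norm_num)).mul_const _
    refine h.congr fun θ hθ => ?_
    rw [uIoc_of_le pi_pos.le] at hθ
    rw [abs_of_pos hθ.1, div_eq_mul_inv θ π, mul_rpow hθ.1.le (inv_nonneg.2 pi_pos.le)]
  have hneg : IntervalIntegrable (fun θ : ℝ => (|θ| / π) ^ (-(1 / 2) : ℝ)) volume (-π) 0 := by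
    have h := ((IntervalIntegrable.iff_comp_neg (by simp)).1 hpos).symm
    simpa only [abs_neg, neg_zero] using h
  exact hneg.trans hpos

/-- Mean value property up to the boundary, for a function on the closed unit disc
whose only singularity is an integrable one at `1`. -/
lemma integral_circleMap_of_norm_le {F : ℂ → ℂ} {C : ℝ}
    (hF : ∀ z : ℂ, ‖z‖ ≤ 1 → z ≠ 1 → DifferentiableAt ℂ F z)
    (hC : ∀ z : ℂ, ‖z‖ ≤ 1 → z ≠ 1 → ‖F z‖ ≤ C * ‖1 - z‖ ^ (-(1 / 2) : ℝ)) :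
    ∫ θ in -π..π, F (circleMap 0 1 θ) = 2 * π * F 0 := by
  have hC0 : 0 ≤ C := by simpa using (norm_nonneg _).trans (hC 0 (by simp) (by simp))
  have hne : ∀ ρ ∈ Ico (0 : ℝ) 1, ∀ θ, circleMap 0 ρ θ ≠ 1 := by
    intro ρ hρ θ h
    have := congrArg norm h
    rw [norm_circleMap_zero, abs_of_nonneg hρ.1, norm_one] at this
    exact hρ.2.ne this
  have hnorm : ∀ ρ ∈ Icc (0 : ℝ) 1, ∀ θ, ‖circleMap 0 ρ θ‖ ≤ 1 := by
    intro ρ hρ θ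
    rw [norm_circleMap_zero, abs_of_nonneg hρ.1]
    exact hρ.2
  have hne1 : ∀ θ : ℝ, |θ| ≤ π → θ ≠ 0 → circleMap 0 1 θ ≠ 1 := by
    intro θ hθ hθ0 h
    have := norm_one_sub_circleMap_ge zero_le_one le_rfl hθ
    rw [h, sub_self, norm_zero] at this
    have : 0 < |θ| / π := by positivity
    linarith
  have hIoo : ∀ᶠ ρ : ℝ in 𝓝[<] 1, ρ ∈ Ioo (0 : ℝ) 1 := Ioo_mem_nhdsLT zero_lt_one
  have hmean : ∀ ρ ∈ Ioo (0 : ℝ) 1, ∫ θ in -π..π, F (circleMap 0 ρ θ) = 2 * π * F 0 := by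
    intro ρ hρ
    have h := circleAverage_of_differentiable_on_off_countable (f := F) (c := 0) (R := ρ)
      countable_empty
      (fun z hz => ?_) (fun z hz => ?_)
    · rw [circleAverage_def] at h
      have hp : Function.Periodic (fun θ => F (circleMap 0 ρ θ)) (2 * π) :=
        fun θ => by simp [periodic_circleMap 0 ρ θ]
      have h2 := hp.intervalIntegral_add_eq 0 (-π)
      rw [show -π + 2 * π = π by ring, zero_add] at h2
      rw [← h2, ← h, Complex.real_smul]
      push_cast
      field_simp
    · rw [mem_closedBall_zero_iff, abs_of_pos hρ.1] at hz
      refine (hF z (hz.trans hρ.2.le) ?_).continuousAt.continuousWithinAt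
      rintro rfl
      rw [norm_one] at hz
      linarith [hρ.2]
    · have hz := hz.1
      rw [mem_ball_zero_iff, abs_of_pos hρ.1] at hz
      refine hF z (hz.le.trans hρ.2.le) ?_
      rintro rfl
      rw [norm_one] at hz
      linarith [hρ.2]
  have hlim : Tendsto (fun ρ => ∫ θ in -π..π, F (circleMap 0 ρ θ)) (𝓝[<] 1)
      (𝓝 (∫ θ in -π..π, F (circleMap 0 1 θ))) := by
    refine intervalIntegral.tendsto_integral_filter_of_dominated_convergence
      (fun θ => C * (|θ| / π) ^ (-(1 / 2) : ℝ)) ?_ ?_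
      (intervalIntegrable_abs_div_pi_rpow.const_mul C) ?_
    · filter_upwards [hIoo] with ρ hρ
      refine Continuous.aestronglyMeasurable (continuous_iff_continuousAt.2 fun θ => ?_)
      exact ContinuousAt.comp (f := circleMap 0 ρ)
        (hF _ (hnorm ρ ⟨hρ.1.le, hρ.2.le⟩ θ) (hne ρ ⟨hρ.1.le, hρ.2⟩ θ)).continuousAt
        (continuous_circleMap 0 ρ).continuousAt
    · filter_upwards [hIoo] with ρ hρ
      filter_upwards [Measure.ae_ne volume (0 : ℝ)] with θ hθ0 hθ
      rw [uIoc_of_le (by linarith [pi_pos])] at hθ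
      exact (hC _ (hnorm ρ ⟨hρ.1.le, hρ.2.le⟩ θ) (hne ρ ⟨hρ.1.le, hρ.2⟩ θ)).trans
        (mul_le_mul_of_nonneg_left (norm_one_sub_circleMap_rpow_le hρ.1.le hρ.2.le
          (abs_le.2 ⟨hθ.1.le, hθ.2⟩) hθ0) hC0)
    · filter_upwards [Measure.ae_ne volume (0 : ℝ)] with θ hθ0 hθ
      rw [uIoc_of_le (by linarith [pi_pos])] at hθ
      have hc : Tendsto (fun ρ : ℝ => circleMap 0 ρ θ) (𝓝[<] 1) (𝓝 (circleMap 0 1 θ)) := by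
        refine (Continuous.tendsto ?_ 1).mono_left nhdsWithin_le_nhds
        unfold circleMap
        fun_prop
      exact (hF _ (hnorm 1 ⟨zero_le_one, le_rfl⟩ θ)
        (hne1 θ (abs_le.2 ⟨hθ.1.le, hθ.2⟩) hθ0)).continuousAt.tendsto.comp hc
  refine tendsto_nhds_unique hlim (tendsto_const_nhds.congr' ?_)
  filter_upwards [hIoo] with ρ hρ using (hmean ρ hρ).symm

/-- The analytic factor `(1 - z)^{1/2} (1 - (√2 - 1)² z)^{1/2}` of the symbol of the
walk on `ℤ²` observed on the horizontal axis. -/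
noncomputable def factor (z : ℂ) : ℂ :=
  (1 - z) ^ ((1 / 2 : ℝ) : ℂ) * (1 - (((√2 - 1) ^ 2 : ℝ) : ℂ) * z) ^ ((1 / 2 : ℝ) : ℂ)

/-- The decay rate in `|y|` of the bounded harmonic function with frequency `θ`. -/
noncomputable def decay (θ : ℝ) : ℝ := 2 - cos θ - √((2 - cos θ) ^ 2 - 1)

lemma sqrt_two_sub_one_sq_mem : (√2 - 1) ^ 2 ∈ Ioo (0 : ℝ) (3 / 4) := by
  have h := sq_sqrt (zero_le_two (α := ℝ))
  have h1 : (1.4 : ℝ) < √2 := lt_sqrt_of_sq_lt (by norm_num)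
  constructor <;> nlinarith

lemma norm_sqrt_two_sub_one_sq_mul_le {z : ℂ} (hz : ‖z‖ ≤ 1) :
    ‖(((√2 - 1) ^ 2 : ℝ) : ℂ) * z‖ ≤ 3 / 4 := by
  obtain ⟨h0, h1⟩ := sqrt_two_sub_one_sq_mem
  rw [norm_mul, Complex.norm_real, norm_eq_abs, abs_of_pos h0]
  nlinarith [norm_nonneg z]

lemma one_sub_mem_slitPlane {z : ℂ} (hz : ‖z‖ ≤ 1) (hz1 : z ≠ 1) :
    1 - z ∈ Complex.slitPlane := by
  rw [Complex.mem_slitPlane_iff]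
  by_contra! h
  have hre : z.re = 1 := by
    have := (Complex.re_le_norm z).trans hz
    have := h.1
    simp at this
    linarith
  have him : z.im = 0 := by simpa using h.2
  exact hz1 (Complex.ext (by simpa) (by simpa))

lemma differentiableAt_factor {z : ℂ} (hz : ‖z‖ ≤ 1) (hz1 : z ≠ 1) :
    DifferentiableAt ℂ factor z := by
  have hα := norm_sqrt_two_sub_one_sq_mul_le hz
  have h2 := one_sub_mem_slitPlane (hα.trans (by norm_num)) fun h => by
    rw [h, norm_one] at hα
    norm_num at hα
  exact (((differentiableAt_const _).sub differentiableAt_id).cpow_const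
    (one_sub_mem_slitPlane hz hz1)).mul
    (((differentiableAt_const _).sub (differentiableAt_id.const_mul _)).cpow_const h2)

lemma norm_factor (z : ℂ) : ‖factor z‖ =
    ‖1 - z‖ ^ (1 / 2 : ℝ) * ‖1 - (((√2 - 1) ^ 2 : ℝ) : ℂ) * z‖ ^ (1 / 2 : ℝ) := by
  rw [factor, norm_mul, Complex.norm_cpow_real, Complex.norm_cpow_real]

lemma norm_one_sub_le_two {z : ℂ} (hz : ‖z‖ ≤ 1) : ‖1 - z‖ ≤ 2 := by
  have := norm_sub_le (1 : ℂ) z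
  rw [norm_one] at this
  linarith

lemma norm_factor_le {z : ℂ} (hz : ‖z‖ ≤ 1) : ‖factor z‖ ≤ 2 := by
  have h2 := norm_one_sub_le_two
    ((norm_sqrt_two_sub_one_sq_mul_le hz).trans (by norm_num))
  rw [norm_factor]
  calc _ ≤ (2 : ℝ) ^ (1 / 2 : ℝ) * 2 ^ (1 / 2 : ℝ) := by
        gcongr
        exact norm_one_sub_le_two hz
    _ = 2 := by rw [← rpow_add two_pos]; norm_num

lemma le_norm_factor {z : ℂ} (hz : ‖z‖ ≤ 1) : 1 / 2 * ‖1 - z‖ ^ (1 / 2 : ℝ) ≤ ‖factor z‖ := by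
  have h2 : (1 / 4 : ℝ) ≤ ‖1 - (((√2 - 1) ^ 2 : ℝ) : ℂ) * z‖ := by
    have := norm_sub_norm_le (1 : ℂ) ((((√2 - 1) ^ 2 : ℝ) : ℂ) * z)
    have := norm_sqrt_two_sub_one_sq_mul_le hz
    rw [norm_one] at *
    linarith
  have h3 : (1 / 2 : ℝ) = (1 / 4 : ℝ) ^ (1 / 2 : ℝ) := by
    rw [← sqrt_eq_rpow, show (1 / 4 : ℝ) = (1 / 2) ^ 2 by norm_num, sqrt_sq (by norm_num)]
  rw [norm_factor, mul_comm]
  gcongr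
  calc (1 / 2 : ℝ) = (1 / 4 : ℝ) ^ (1 / 2 : ℝ) := h3
    _ ≤ _ := by gcongr

lemma norm_inv_factor_le {z : ℂ} (hz : ‖z‖ ≤ 1) (hz1 : z ≠ 1) :
    ‖(factor z)⁻¹‖ ≤ 2 * ‖1 - z‖ ^ (-(1 / 2) : ℝ) := by
  have h0 : 0 < ‖1 - z‖ := norm_pos_iff.2 (sub_ne_zero.2 hz1.symm)
  have h1 : 0 < ‖1 - z‖ ^ (1 / 2 : ℝ) := by positivity
  rw [norm_inv, rpow_neg h0.le]
  calc _ ≤ (1 / 2 * ‖1 - z‖ ^ (1 / 2 : ℝ))⁻¹ := by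
        gcongr
        exact le_norm_factor hz
    _ = _ := by rw [mul_inv]; norm_num

lemma factor_ne_zero {z : ℂ} (hz : ‖z‖ ≤ 1) (hz1 : z ≠ 1) : factor z ≠ 0 := by
  have h0 : 0 < ‖1 - z‖ := norm_pos_iff.2 (sub_ne_zero.2 hz1.symm)
  have : 0 < 1 / 2 * ‖1 - z‖ ^ (1 / 2 : ℝ) := by positivity
  exact norm_pos_iff.1 (this.trans_le (le_norm_factor hz))

@[simp] lemma factor_zero : factor 0 = 1 := by simp [factor]

lemma integral_inv_factor_mul_pow (n : ℕ) :
    ∫ θ in -π..π, (factor (circleMap 0 1 θ))⁻¹ * circleMap 0 1 θ ^ n = 2 * π * 0 ^ n := by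
  have h := integral_circleMap_of_norm_le (F := fun z => (factor z)⁻¹ * z ^ n) (C := 2)
    (fun z hz hz1 => ((differentiableAt_factor hz hz1).inv (factor_ne_zero hz hz1)).mul
      (differentiableAt_id.pow n)) (fun z hz hz1 => ?_)
  · simpa using h
  · rw [norm_mul, norm_pow]
    exact mul_le_of_le_one_right (norm_nonneg _) (pow_le_one₀ (norm_nonneg _) hz) |>.trans
      (norm_inv_factor_le hz hz1)

lemma integral_factor_mul_pow (n : ℕ) :
    ∫ θ in -π..π, factor (circleMap 0 1 θ) * circleMap 0 1 θ ^ n = 2 * π * 0 ^ n := by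
  have h := integral_circleMap_of_norm_le (F := fun z => factor z * z ^ n) (C := 4)
    (fun z hz hz1 => (differentiableAt_factor hz hz1).mul
      (differentiableAt_id.pow n)) (fun z hz hz1 => ?_)
  · simpa using h
  · rw [norm_mul, norm_pow]
    refine mul_le_of_le_one_right (norm_nonneg _) (pow_le_one₀ (norm_nonneg _) hz) |>.trans
      ((norm_factor_le hz).trans ?_)
    have h0 : 0 < ‖1 - z‖ := norm_pos_iff.2 (sub_ne_zero.2 hz1.symm)
    have h1 : (2 : ℝ) ^ (-1 : ℝ) ≤ ‖1 - z‖ ^ (-(1 / 2) : ℝ) :=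
      calc (2 : ℝ) ^ (-1 : ℝ) ≤ 2 ^ (-(1 / 2) : ℝ) :=
            rpow_le_rpow_of_exponent_le one_le_two (by norm_num)
        _ ≤ _ := rpow_le_rpow_of_nonpos h0 (norm_one_sub_le_two hz) (by norm_num)
    rw [rpow_neg_one] at h1
    linarith

lemma sq_two_sub_cos_sub_one_nonneg (θ : ℝ) : 0 ≤ (2 - cos θ) ^ 2 - 1 := by
  nlinarith [cos_le_one θ]

lemma decay_nonneg (θ : ℝ) : 0 ≤ decay θ := by
  rw [decay, sub_nonneg, sqrt_le_iff]
  constructor <;> linarith [cos_le_one θ]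

lemma decay_sq (θ : ℝ) : decay θ ^ 2 + 1 = (4 - 2 * cos θ) * decay θ := by
  rw [decay]
  linear_combination sq_sqrt (sq_two_sub_cos_sub_one_nonneg θ)

lemma decay_le_one (θ : ℝ) : decay θ ≤ 1 := by
  rw [decay, sub_le_comm]
  refine le_sqrt_of_sq_le ?_
  nlinarith [cos_le_one θ]

lemma decay_lt_one {θ : ℝ} (hθ : cos θ ≠ 1) : decay θ < 1 := by
  rw [decay, sub_lt_comm]
  have := (cos_le_one θ).lt_of_ne hθ
  refine lt_sqrt_of_sq_lt ?_
  nlinarith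

lemma continuous_decay : Continuous decay := by
  unfold decay
  fun_prop

lemma factor_mul_conj_factor (θ : ℝ) :
    factor (circleMap 0 1 θ) * conj (factor (circleMap 0 1 θ)) =
      (((√2 - 1) * (4 - 2 * cos θ - 2 * decay θ) : ℝ) : ℂ) := by
  have h2 := sq_sqrt (zero_le_two (α := ℝ))
  have h1 : (1 : ℝ) < √2 := lt_sqrt_of_sq_lt (by norm_num)
  have hns : ∀ t : ℝ, ‖1 - (t : ℂ) * circleMap 0 1 θ‖ ^ 2 = 1 + t ^ 2 - 2 * t * cos θ := by
    intro t
    rw [← Complex.normSq_eq_norm_sq, Complex.normSq_apply]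
    simp [circleMap, Complex.exp_re, Complex.exp_im]
    linear_combination t ^ 2 * sin_sq_add_cos_sq θ
  rw [Complex.mul_conj, Complex.normSq_eq_norm_sq, norm_factor]
  congr 1
  rw [← sqrt_eq_rpow, ← sqrt_eq_rpow, mul_pow, sq_sqrt (norm_nonneg _), sq_sqrt (norm_nonneg _),
    decay]
  refine (sq_eq_sq₀ (by positivity) (mul_nonneg (by linarith) ?_)).1 ?_
  · linarith [sqrt_nonneg ((2 - cos θ) ^ 2 - 1)]
  have ha := hns 1
  rw [Complex.ofReal_one, one_mul] at ha
  rw [mul_pow, ha, hns]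
  have hs := sq_sqrt (sq_two_sub_cos_sub_one_nonneg θ)
  have hα : (1 : ℝ) + ((√2 - 1) ^ 2) ^ 2 = 6 * (√2 - 1) ^ 2 := by nlinarith
  rw [hα]
  linear_combination (-4) * (√2 - 1) ^ 2 * hs

/-- The Fourier transform in the first coordinate of the Green's function. -/
noncomputable def integrand (x y : ℤ) (θ : ℝ) : ℂ :=
  (((√2 - 1 : ℝ) : ℂ) * (factor (circleMap 0 1 θ))⁻¹ * (decay θ : ℂ) ^ y.natAbs) *
    circleMap 0 1 θ ^ (-x)

/-- An explicit Fourier integral for the Green's function. -/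
noncomputable def green (v : ℤ × ℤ) : ℝ :=
  (2 * π)⁻¹ * (∫ θ in -π..π, integrand v.1 v.2 θ).re

lemma circleMap_one_ne_zero (θ : ℝ) : circleMap 0 1 θ ≠ 0 := circleMap_ne_center one_ne_zero

lemma norm_circleMap_one (θ : ℝ) : ‖circleMap 0 1 θ‖ = 1 := by
  rw [norm_circleMap_zero, abs_one]

lemma measurable_integrand (x y : ℤ) : Measurable (integrand x y) := by
  have hf : Measurable factor := by
    unfold factor
    fun_prop
  have hc : Measurable (circleMap 0 1) := (continuous_circleMap 0 1).measurable
  have hd : Measurable decay := continuous_decay.measurable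
  have hz : Measurable fun θ : ℝ => circleMap 0 1 θ ^ (-x) :=
    ((continuous_circleMap 0 1).zpow₀ (-x) fun θ => Or.inl (circleMap_one_ne_zero θ)).measurable
  have hfc : Measurable fun θ : ℝ => factor (circleMap 0 1 θ) := hf.comp hc
  unfold integrand
  fun_prop

lemma norm_integrand_le {θ : ℝ} (hθ : |θ| ≤ π) (hθ0 : θ ≠ 0) (x y : ℤ) :
    ‖integrand x y θ‖ ≤ 2 * (|θ| / π) ^ (-(1 / 2) : ℝ) * decay θ ^ y.natAbs := by
  have hne : circleMap 0 1 θ ≠ 1 := by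
    intro h
    have := norm_one_sub_circleMap_ge zero_le_one le_rfl hθ
    rw [h, sub_self, norm_zero] at this
    have : 0 < |θ| / π := by positivity
    linarith
  have h1 : 1 ≤ √2 := one_le_sqrt.2 one_le_two
  have h2 : √2 ≤ 2 := sqrt_le_iff.2 (by norm_num)
  have hs : ‖((√2 - 1 : ℝ) : ℂ)‖ ≤ 1 := by
    rw [Complex.norm_real, norm_eq_abs, abs_of_nonneg (by linarith)]
    linarith
  rw [integrand, norm_mul, norm_mul, norm_mul, norm_zpow, norm_circleMap_one, one_zpow, mul_one,
    norm_pow, Complex.norm_real (decay θ), norm_eq_abs (decay θ), abs_of_nonneg (decay_nonneg θ)]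
  refine mul_le_mul_of_nonneg_right ?_ (pow_nonneg (decay_nonneg θ) _)
  refine (mul_le_of_le_one_left (norm_nonneg _) hs).trans
    ((norm_inv_factor_le (norm_circleMap_one θ).le hne).trans ?_)
  exact mul_le_mul_of_nonneg_left
    (norm_one_sub_circleMap_rpow_le zero_le_one le_rfl hθ hθ0) zero_le_two

lemma ae_norm_integrand_le (x y : ℤ) : ∀ᵐ θ : ℝ, θ ∈ uIoc (-π) π →
    ‖integrand x y θ‖ ≤ 2 * (|θ| / π) ^ (-(1 / 2) : ℝ) * decay θ ^ y.natAbs := by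
  filter_upwards [Measure.ae_ne volume (0 : ℝ)] with θ hθ0 hθ
  rw [uIoc_of_le (by linarith [pi_pos])] at hθ
  exact norm_integrand_le (abs_le.2 ⟨hθ.1.le, hθ.2⟩) hθ0 x y

lemma intervalIntegrable_bound (n : ℕ) : IntervalIntegrable
    (fun θ : ℝ => 2 * (|θ| / π) ^ (-(1 / 2) : ℝ) * decay θ ^ n) volume (-π) π :=
  (intervalIntegrable_abs_div_pi_rpow.const_mul 2).mul_continuousOn
    (continuous_decay.pow n).continuousOn

lemma intervalIntegrable_integrand (x y : ℤ) :
    IntervalIntegrable (integrand x y) volume (-π) π := by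
  refine (intervalIntegrable_bound y.natAbs).mono_fun'
    (measurable_integrand x y).aestronglyMeasurable ?_
  exact (ae_restrict_iff' measurableSet_uIoc).2
    (ae_norm_integrand_le x y)

lemma abs_green_le (v : ℤ × ℤ) : |green v| ≤ (2 * π)⁻¹ *
    ∫ θ in -π..π, 2 * (|θ| / π) ^ (-(1 / 2) : ℝ) * decay θ ^ v.2.natAbs := by
  rw [green, abs_mul, abs_of_pos (by positivity : 0 < (2 * π)⁻¹)]
  refine mul_le_mul_of_nonneg_left ((Complex.abs_re_le_norm _).trans ?_) (by positivity)
  refine intervalIntegral.norm_integral_le_of_norm_le (by linarith [pi_pos]) ?_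
    (intervalIntegrable_bound _)
  filter_upwards [ae_norm_integrand_le v.1 v.2] with θ h hθ
  exact h (by rwa [uIoc_of_le (by linarith [pi_pos])])

lemma tendsto_integral_bound : Tendsto (fun n : ℕ =>
    ∫ θ in -π..π, 2 * (|θ| / π) ^ (-(1 / 2) : ℝ) * decay θ ^ n) atTop (𝓝 0) := by
  have h := intervalIntegral.tendsto_integral_filter_of_dominated_convergence (l := atTop)
    (a := -π) (b := π) (μ := volume) (f := fun _ => (0 : ℝ))
    (F := fun (n : ℕ) θ => 2 * (|θ| / π) ^ (-(1 / 2) : ℝ) * decay θ ^ n)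
    (fun θ => 2 * (|θ| / π) ^ (-(1 / 2) : ℝ)) ?_ ?_
    (intervalIntegrable_abs_div_pi_rpow.const_mul 2) ?_
  · simpa using h
  · refine .of_forall fun n => Measurable.aestronglyMeasurable ?_
    have := continuous_decay.measurable
    fun_prop
  · refine .of_forall fun n => .of_forall fun θ _ => ?_
    rw [norm_mul, norm_of_nonneg (by positivity), norm_of_nonneg (pow_nonneg (decay_nonneg θ) _)]
    exact mul_le_of_le_one_right (by positivity) (pow_le_one₀ (decay_nonneg θ) (decay_le_one θ))
  · filter_upwards [Measure.ae_ne volume (0 : ℝ)] with θ hθ0 hθ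
    rw [uIoc_of_le (by linarith [pi_pos])] at hθ
    have hcos : cos θ ≠ 1 := by
      rw [Ne, cos_eq_one_iff_of_lt_of_lt (by linarith [hθ.1, pi_pos]) (by linarith [hθ.2, pi_pos])]
      exact hθ0
    simpa using (tendsto_pow_atTop_nhds_zero_of_lt_one (decay_nonneg θ)
      (decay_lt_one hcos)).const_mul (2 * (|θ| / π) ^ (-(1 / 2) : ℝ))

lemma tendsto_green_row (y : ℤ) : Tendsto (fun x : ℤ => green (x, y)) cofinite (𝓝 0) := by
  have hscale : Tendsto (fun x : ℤ => (x : ℝ) * (2 * π)⁻¹) cofinite (cocompact ℝ) :=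
    (Homeomorph.mulRight₀ (2 * π)⁻¹ (by positivity)).isClosedEmbedding.tendsto_cocompact.comp
      Int.tendsto_coe_cofinite
  have h := (Real.tendsto_integral_exp_smul_cocompact
    ((Ioc (-π) π).indicator (integrand 0 y))).comp hscale
  have h2 := ((Complex.continuous_re.tendsto 0).comp h).const_mul (2 * π)⁻¹
  rw [Complex.zero_re, mul_zero] at h2
  refine h2.congr fun x => ?_
  simp only [Function.comp_apply, green]
  rw [intervalIntegral.integral_of_le (by linarith [pi_pos]),
    ← integral_indicator measurableSet_Ioc]
  congr 3
  ext θ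
  by_cases hθ : θ ∈ Ioc (-π) π
  · rw [indicator_of_mem hθ, indicator_of_mem hθ, integrand, integrand, Circle.smul_def,
      Real.fourierChar_apply, neg_zero, zpow_zero, mul_one, smul_eq_mul, mul_comm]
    congr 1
    rw [circleMap, Complex.ofReal_one, one_mul, zero_add, ← Complex.exp_int_mul]
    congr 1
    push_cast
    field_simp
  · simp [indicator_of_notMem hθ]

lemma tendsto_green : Tendsto green cofinite (𝓝 0) := by
  rw [Metric.tendsto_nhds]
  intro ε hε
  have hcol := tendsto_integral_bound.const_mul (2 * π)⁻¹
  rw [mul_zero] at hcol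
  obtain ⟨N, hN⟩ := eventually_atTop.1 (hcol.eventually_lt_const hε)
  have hfin : (⋃ y ∈ Ioo (-(N : ℤ)) N, (fun x : ℤ => (x, y)) ''
      {x | ¬ dist (green (x, y)) 0 < ε}).Finite :=
    (finite_Ioo _ _).biUnion fun y _ =>
      (eventually_cofinite.1 (Metric.tendsto_nhds.1 (tendsto_green_row y) ε hε)).image _
  refine eventually_cofinite.2 (hfin.subset ?_)
  rintro ⟨x, y⟩ hv
  refine mem_biUnion (x := y) ?_ ⟨x, hv, rfl⟩
  by_contra hy
  refine hv ?_
  rw [Real.dist_eq, sub_zero]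
  refine (abs_green_le (x, y)).trans_lt (hN y.natAbs ?_)
  rw [mem_Ioo] at hy
  omega

lemma four_mul_green_sub (v : ℤ × ℤ) :
    4 * green v - (green (v.1 + 1, v.2) + green (v.1 - 1, v.2) + green (v.1, v.2 + 1) +
      green (v.1, v.2 - 1)) =
    (2 * π)⁻¹ * (∫ θ in -π..π, (4 * integrand v.1 v.2 θ - (integrand (v.1 + 1) v.2 θ +
      integrand (v.1 - 1) v.2 θ + integrand v.1 (v.2 + 1) θ + integrand v.1 (v.2 - 1) θ))).re := by
  have hi := intervalIntegrable_integrand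
  rw [intervalIntegral.integral_sub ((hi _ _).const_mul 4)
      ((((hi _ _).add (hi _ _)).add (hi _ _)).add (hi _ _)),
    intervalIntegral.integral_add (((hi _ _).add (hi _ _)).add (hi _ _)) (hi _ _),
    intervalIntegral.integral_add ((hi _ _).add (hi _ _)) (hi _ _),
    intervalIntegral.integral_add (hi _ _) (hi _ _), intervalIntegral.integral_const_mul]
  simp only [green, Complex.sub_re, Complex.add_re, Complex.mul_re, Complex.re_ofNat,
    Complex.im_ofNat, zero_mul, sub_zero]
  ring

lemma circleMap_zpow_add (θ : ℝ) (x : ℤ) :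
    circleMap 0 1 θ ^ (-(x + 1)) + circleMap 0 1 θ ^ (-(x - 1)) =
      ((2 * cos θ : ℝ) : ℂ) * circleMap 0 1 θ ^ (-x) := by
  have h0 := circleMap_one_ne_zero θ
  have hcos : ((2 * cos θ : ℝ) : ℂ) = circleMap 0 1 θ + (circleMap 0 1 θ)⁻¹ := by
    rw [circleMap]
    push_cast
    rw [Complex.cos, one_mul, zero_add, ← Complex.exp_neg, neg_mul]
    ring
  rw [hcos, neg_add, neg_sub', sub_neg_eq_add, zpow_add₀ h0, zpow_add₀ h0, zpow_neg_one, zpow_one]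
  ring

lemma laplacian_integrand_of_ne_zero {y : ℤ} (hy : y ≠ 0) (x : ℤ) (θ : ℝ) :
    4 * integrand x y θ - (integrand (x + 1) y θ + integrand (x - 1) y θ +
      integrand x (y + 1) θ + integrand x (y - 1) θ) = 0 := by
  have hd : (decay θ : ℂ) ^ (y + 1).natAbs + (decay θ : ℂ) ^ (y - 1).natAbs =
      ((4 - 2 * cos θ : ℝ) : ℂ) * (decay θ : ℂ) ^ y.natAbs := by
    norm_cast
    obtain ⟨n, hn⟩ := Nat.exists_eq_succ_of_ne_zero (Int.natAbs_ne_zero.2 hy)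
    have hpow : decay θ ^ (n + 2) + decay θ ^ n = (4 - 2 * cos θ) * decay θ ^ (n + 1) := by
      linear_combination decay θ ^ n * decay_sq θ
    rcases hy.lt_or_gt with h | h
    · rw [show (y + 1).natAbs = n by omega, show (y - 1).natAbs = n + 2 by omega, hn, add_comm]
      exact hpow
    · rw [show (y + 1).natAbs = n + 2 by omega, show (y - 1).natAbs = n by omega, hn]
      exact hpow
  have hz := circleMap_zpow_add θ x
  simp only [integrand]
  push_cast at hd hz ⊢
  linear_combination (-(((√2 : ℝ) : ℂ) - 1) * (factor (circleMap 0 1 θ))⁻¹) *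
    ((decay θ : ℂ) ^ y.natAbs * hz + circleMap 0 1 θ ^ (-x) * hd)

lemma laplacian_integrand_axis (n : ℕ) (θ : ℝ) :
    4 * integrand n 0 θ - (integrand (n + 1) 0 θ + integrand (n - 1) 0 θ +
      integrand n (0 + 1) θ + integrand n (0 - 1) θ) =
    conj (factor (circleMap 0 1 θ) * circleMap 0 1 θ ^ n) := by
  have hz := circleMap_zpow_add θ n
  have hconj : conj (circleMap 0 1 θ) = (circleMap 0 1 θ)⁻¹ := by
    rw [Complex.inv_def, Complex.normSq_eq_norm_sq, norm_circleMap_one]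
    simp
  have hf := factor_mul_conj_factor θ
  have hlhs : 4 * integrand n 0 θ - (integrand (n + 1) 0 θ + integrand (n - 1) 0 θ +
      integrand n (0 + 1) θ + integrand n (0 - 1) θ) =
      (factor (circleMap 0 1 θ))⁻¹ * (factor (circleMap 0 1 θ) *
        conj (factor (circleMap 0 1 θ))) * circleMap 0 1 θ ^ (-(n : ℤ)) := by
    rw [hf]
    simp only [integrand, zero_add, zero_sub, Int.natAbs_neg, Int.natAbs_zero, Int.natAbs_one,
      pow_zero, pow_one]
    push_cast at hz ⊢
    linear_combination (-(((√2 : ℝ) : ℂ) - 1) * (factor (circleMap 0 1 θ))⁻¹) * hz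
  rw [hlhs, map_mul, map_pow, hconj, zpow_neg, zpow_natCast, inv_pow]
  by_cases h0 : factor (circleMap 0 1 θ) = 0
  · simp [h0]
  · rw [inv_mul_cancel_left₀ h0]

lemma green_axis (n : ℕ) : green (-n, 0) = (√2 - 1) * 0 ^ n := by
  have h : ∀ θ, integrand (-n) 0 θ = ((√2 - 1 : ℝ) : ℂ) *
      ((factor (circleMap 0 1 θ))⁻¹ * circleMap 0 1 θ ^ n) := by
    intro θ
    simp [integrand, mul_assoc]
  simp only [green]
  rw [intervalIntegral.integral_congr fun θ _ => h θ, intervalIntegral.integral_const_mul,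
    integral_inv_factor_mul_pow]
  norm_cast
  field_simp

lemma isRayGreen_green : IsRayGreen green := by
  refine ⟨?_, ?_, tendsto_green, ?_⟩
  · refine ⟨(2 * π)⁻¹ * ∫ θ in -π..π, 2 * (|θ| / π) ^ (-(1 / 2) : ℝ) * decay θ ^ 0,
      fun v => (abs_green_le v).trans (mul_le_mul_of_nonneg_left ?_ (by positivity))⟩
    refine intervalIntegral.integral_mono_on (by linarith [pi_pos]) (intervalIntegrable_bound _)
      (intervalIntegrable_bound _) fun θ _ => mul_le_mul_of_nonneg_left ?_ (by positivity)
    rw [pow_zero]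
    exact pow_le_one₀ (decay_nonneg θ) (decay_le_one θ)
  · rintro ⟨x, y⟩ ⟨hy, hx⟩
    obtain ⟨n, rfl⟩ : ∃ n : ℕ, x = -n := ⟨x.natAbs, by simp only at hx; omega⟩
    obtain rfl : y = 0 := hy
    rw [green_axis, zero_pow (by rintro rfl; simp at hx), mul_zero]
  · rintro ⟨x, y⟩ hv
    rw [four_mul_green_sub]
    by_cases hy : y = 0
    · subst hy
      obtain ⟨n, rfl⟩ : ∃ n : ℕ, x = n := ⟨x.natAbs, by simp only [true_and] at hv; omega⟩
      simp only [laplacian_integrand_axis]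
      rw [intervalIntegral.intervalIntegral_conj, Complex.conj_re, integral_factor_mul_pow]
      rcases n.eq_zero_or_pos with rfl | hn
      · norm_num
        field_simp
      · simp [hn.ne']
    · simp [laplacian_integrand_of_ne_zero hy, hy]

/-- Maximum principle for functions that are harmonic off the ray, vanish on it, and tend to `0`. -/
lemma nonpos_of_harmonic {d : ℤ × ℤ → ℝ} (hray : ∀ v : ℤ × ℤ, (v.2 = 0 ∧ v.1 ≤ -1) → d v = 0)
    (hlim : Tendsto d cofinite (𝓝 0))
    (hharm : ∀ v : ℤ × ℤ, ¬(v.2 = 0 ∧ v.1 ≤ -1) →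
      4 * d v = d (v.1 + 1, v.2) + d (v.1 - 1, v.2) + d (v.1, v.2 + 1) + d (v.1, v.2 - 1))
    (v : ℤ × ℤ) : d v ≤ 0 := by
  by_contra! hv
  have hfin : {w | d v ≤ d w}.Finite := by
    simpa only [not_lt] using eventually_cofinite.1 (hlim.eventually_lt_const hv)
  obtain ⟨m, hm, hmax⟩ := exists_max_image _ d hfin ⟨v, le_refl (d v)⟩
  have hmax' : ∀ w, d w ≤ d m := fun w =>
    (le_total (d v) (d w)).elim (hmax w) fun h => h.trans hm
  have hpos : 0 < d m := hv.trans_le hm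
  have hstep : ∀ n : ℕ, d (m.1 + n, m.2) = d m := by
    intro n
    induction n with
    | zero => simp
    | succ n ih =>
      have h := hharm (m.1 + n, m.2) fun h => by
        rw [hray _ h] at ih
        exact hpos.ne ih
      have h1 := hmax' (m.1 + n + 1, m.2)
      have h2 := hmax' (m.1 + n - 1, m.2)
      have h3 := hmax' (m.1 + n, m.2 + 1)
      have h4 := hmax' (m.1 + n, m.2 - 1)
      push_cast
      rw [← add_assoc]
      simp only at h
      linarith
  refine infinite_range_of_injective (f := fun n : ℕ => (m.1 + (n : ℤ), m.2))
    (fun a b h => by simpa using h) (hfin.subset ?_)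
  rintro _ ⟨n, rfl⟩
  exact hm.trans (hstep n).ge

lemma le_of_isRayGreen {g h : ℤ × ℤ → ℝ} (hg : IsRayGreen g) (hh : IsRayGreen h) : g ≤ h := by
  intro v
  refine sub_nonpos.1 (nonpos_of_harmonic (d := fun v => g v - h v) (fun w hw => ?_) ?_
    (fun w hw => ?_) v)
  · rw [hg.2.1 w hw, hh.2.1 w hw, sub_zero]
  · simpa using hg.2.2.1.sub hh.2.2.1
  · linear_combination hg.2.2.2 w hw - hh.2.2.2 w hw

end RayGreen

/-- There is exactly one Green's function of `ℤ²` with Dirichlet boundary on the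
negative horizontal ray and source at the origin, and its value at the origin is
`√2 - 1`. -/
theorem rayGreen_existsUnique_and_value :
    (∃! h : ℤ × ℤ → ℝ, IsRayGreen h) ∧
    (∀ h : ℤ × ℤ → ℝ, IsRayGreen h → h (0, 0) = Real.sqrt 2 - 1) := by
  have huniq : ∀ h, IsRayGreen h → h = RayGreen.green := fun h hh =>
    le_antisymm (RayGreen.le_of_isRayGreen hh RayGreen.isRayGreen_green)
      (RayGreen.le_of_isRayGreen RayGreen.isRayGreen_green hh)
  refine ⟨⟨RayGreen.green, RayGreen.isRayGreen_green, huniq⟩, fun h hh => ?_⟩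
  rw [huniq h hh]
  simpa using RayGreen.green_axis 0
end
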